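/- arXiv:2102.13415 — 3 statements merged into one kernel-verified Lean document; each statement's English description precedes it below -/
import Mathlib

section
/- Let M ≥ 2 be an integer and let H : [0,1] → ℝ be bounded and measurable such that for every k ∈ {1, …, M−1} there exist ε > 0, α ∈ (0,1] and L ≥ 0 with |H(x) − H(y)| ≤ L|x − y|^α for all x, y ∈ (y_k − ε, y_k + ε) ∩ [0,1] (H is Hölder continuous in a neighborhood of each interior grid point). Then for each k ∈ {1, …, M−1} the limit H_k := lim_{n→∞} ∑_{l=1}^{n} (𝟙_{I_k^+}(l) − 𝟙_{I_k^-}(l)) h_l exists, and H_k = ⟨H, e_k⟩_M. -/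
open Real Filter MeasureTheory Topology

/-- The sine basis functions `e_ℓ(y) = √2 sin(πℓy)`. -/
noncomputable def sineB (ℓ : ℕ) (y : ℝ) : ℝ := Real.sqrt 2 * Real.sin (Real.pi * ℓ * y)

/-- The Fourier sine coefficients `h_ℓ = ∫₀¹ H(y) e_ℓ(y) dy`. -/
noncomputable def fourierSineCoef (H : ℝ → ℝ) (ℓ : ℕ) : ℝ :=
  ∫ y in (0 : ℝ)..1, H y * sineB ℓ y

/-- The discrete inner product `⟨H, e_k⟩_M = (1/M) ∑_{l=1}^{M−1} H(l/M) e_k(l/M)`. -/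
noncomputable def discIP (M : ℕ) (H : ℝ → ℝ) (k : ℕ) : ℝ :=
  (1 / (M : ℝ)) * ∑ l ∈ Finset.Icc 1 (M - 1), H ((l : ℝ) / M) * sineB k ((l : ℝ) / M)

lemma aux_RL (q : ℝ → ℝ) (a b : ℝ) (hab : a ≤ b) (hq : IntervalIntegrable q volume a b) :
    Tendsto (fun w : ℝ => ∫ x in a..b, q x * Real.sin (π * w * x)) atTop (𝓝 0) := by
  have h := Real.tendsto_integral_exp_smul_cocompact
    (fun x => (((Set.Ioc a b).indicator q x : ℝ) : ℂ))
  have hw : Tendsto (fun w : ℝ => w / 2) atTop (cocompact ℝ) :=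
    (tendsto_id.atTop_div_const (by norm_num : (0:ℝ) < 2)).mono_right atTop_le_cocompact
  have h2 := (Complex.continuous_im.tendsto 0).comp (h.comp hw)
  have h3 := h2.neg
  simp only [Complex.zero_im, neg_zero] at h3
  refine h3.congr fun w => ?_
  simp only [Function.comp]
  have hi : Integrable ((Set.Ioc a b).indicator q) := by
    rw [integrable_indicator_iff measurableSet_Ioc]
    exact (intervalIntegrable_iff_integrableOn_Ioc_of_le hab).1 hq
  have hint : Integrable (fun v : ℝ => Real.fourierChar (-(v * (w/2))) •
      (((Set.Ioc a b).indicator q v : ℝ) : ℂ)) := by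
    have hi' : Integrable (fun v => (((Set.Ioc a b).indicator q v : ℝ) : ℂ)) := hi.ofReal
    refine hi'.mono ?_ ?_
    · exact (by fun_prop : Continuous fun v : ℝ => Real.fourierChar (-(v * (w/2)))).aestronglyMeasurable.smul
        hi'.aestronglyMeasurable
    · exact Eventually.of_forall fun v => by
        rw [Circle.smul_def, norm_smul, Circle.norm_coe, one_mul]
  have him : ∀ (f : ℝ → ℂ), Integrable f → (∫ v, f v).im = ∫ v, (f v).im := fun f hf =>
    (integral_im hf).symm
  rw [him _ hint, intervalIntegral.integral_of_le hab, ← integral_indicator measurableSet_Ioc,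
    ← integral_neg]
  congr 1
  ext v
  rw [Circle.smul_def, Real.fourierChar_apply]
  by_cases hv : v ∈ Set.Ioc a b
  · simp only [Set.indicator_of_mem hv, smul_eq_mul, Complex.im_mul_ofReal, Complex.exp_ofReal_mul_I_im]
    rw [show 2 * π * -(v * (w/2)) = -(π * w * v) by ring, Real.sin_neg]
    ring
  · simp [Set.indicator_of_notMem hv]

lemma aux_subseq (c : ℕ) (hc : 0 < c) (u : ℕ → ℝ) (s : ℝ) (hu : Tendsto u atTop (𝓝 0))
    (hs : Tendsto (fun N => ∑ l ∈ Finset.range (c * N), u l) atTop (𝓝 s)) :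
    Tendsto (fun n => ∑ l ∈ Finset.range n, u l) atTop (𝓝 s) := by
  have hdiv : Tendsto (fun n : ℕ => n / c) atTop atTop := Nat.tendsto_div_const_atTop hc.ne'
  have h1 := hs.comp hdiv
  have h2 : Tendsto (fun n : ℕ => ∑ r ∈ Finset.range c, if r < n % c then u (c * (n / c) + r) else 0)
      atTop (𝓝 0) := by
    have : Tendsto (fun n : ℕ => ∑ r ∈ Finset.range c, if r < n % c then u (c * (n / c) + r) else 0)
      atTop (𝓝 (∑ r ∈ Finset.range c, 0)) := by
      apply tendsto_finsetSum
      intro r _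
      have h3 : Tendsto (fun n : ℕ => u (c * (n / c) + r)) atTop (𝓝 0) :=
        by
        refine hu.comp (tendsto_atTop_mono (fun n => ?_) hdiv)
        nlinarith [Nat.zero_le (n / c)]
      refine squeeze_zero_norm (a := fun n => ‖u (c * (n / c) + r)‖) (fun n => ?_) (by simpa using h3.norm)
      split_ifs <;> simp
    simpa using this
  have h3 := h1.add h2
  rw [add_zero] at h3
  refine h3.congr fun n => ?_
  simp only [Function.comp]
  conv_rhs => rw [← Nat.div_add_mod n c, Finset.sum_range_add]
  congr 1
  rw [← Finset.sum_filter]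
  congr 1
  ext r
  have := Nat.mod_lt n hc
  simp; omega

noncomputable def auxK (N : ℕ) (t : ℝ) : ℝ :=
  ∑ j ∈ Finset.range N, (Real.cos (2 * t * (j + 1)) + Real.cos (2 * t * j))

lemma auxK_cont (N : ℕ) : Continuous (auxK N) := by
  unfold auxK; fun_prop

lemma auxK_sin (N : ℕ) (b : ℝ) : auxK N b * Real.sin b = Real.cos b * Real.sin (2 * b * N) := by
  unfold auxK
  induction N with
  | zero => simp
  | succ n ih =>
    rw [Finset.sum_range_succ, add_mul, ih]
    push_cast
    rw [show 2 * b * ((n:ℝ)+1) = 2 * b * n + b + b by ring]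
    generalize 2 * b * (n:ℝ) = x
    simp only [Real.sin_add, Real.cos_add]
    have := Real.sin_sq_add_cos_sq b
    grind

lemma auxS (N : ℕ) (a b : ℝ) :
    ∑ j ∈ Finset.range N, (Real.sin (a + 2 * b * j) - Real.sin (2 * b - a + 2 * b * j))
      = Real.sin a * auxK N b - Real.cos a * Real.sin (2 * b * N) := by
  unfold auxK
  induction N with
  | zero => simp
  | succ n ih =>
    rw [Finset.sum_range_succ, Finset.sum_range_succ, ih]
    push_cast
    rw [show 2 * b - a + 2 * b * (n:ℝ) = 2 * b * ((n:ℝ)+1) - a by ring]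
    rw [Real.sin_add, Real.sin_sub]
    ring

lemma auxK_integral (N : ℕ) (hN : 1 ≤ N) :
    ∫ t in (-(1/2) : ℝ)..(1/2), auxK N (π * t) = 1 := by
  have hc : ∀ j : ℕ, 1 ≤ j → ∫ t in (-(1/2) : ℝ)..(1/2), Real.cos (2 * (π * t) * j) = 0 := by
    intro j hj
    have hj0 : (2 * π * j : ℝ) ≠ 0 := by positivity
    have := intervalIntegral.integral_comp_mul_left (a := -(1/2)) (b := 1/2) Real.cos hj0
    rw [show (fun t : ℝ => Real.cos (2 * (π * t) * j)) = fun t => Real.cos (2 * π * j * t) by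
      ext t; ring_nf, this, integral_cos]
    rw [show 2 * π * j * (1/2) = j * π by ring, show 2 * π * j * -(1/2) = -(j * π) by ring]
    simp [Real.sin_nat_mul_pi]
  induction N, hN using Nat.le_induction with
  | base =>
    have := hc 1 le_rfl
    simp only [auxK, Finset.sum_range_one]
    rw [intervalIntegral.integral_add]
    · simp at this ⊢
      rw [this]; norm_num
    all_goals exact (by fun_prop : Continuous _).intervalIntegrable _ _
  | succ n hn ih =>
    have h1 := hc n hn
    have h2 := hc (n+1) (by omega)
    have : ∀ t, auxK (n+1) (π * t) = auxK n (π * t) + (Real.cos (2 * (π * t) * ((n+1:ℕ):ℝ)) + Real.cos (2 * (π * t) * n)) := by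
      intro t; simp only [auxK]; rw [Finset.sum_range_succ]; push_cast; rfl
    simp only [this]
    have := auxK_cont n
    rw [intervalIntegral.integral_add, intervalIntegral.integral_add, ih, h1, h2]
    · simp
    all_goals exact (by fun_prop : Continuous _).intervalIntegrable _ _

lemma aux_abs_rpow (α : ℝ) (hα : 0 < α) :
    IntervalIntegrable (fun t : ℝ => |t| ^ (α - 1)) volume (-(1/2)) (1/2) := by
  have h1 : IntervalIntegrable (fun t : ℝ => |t| ^ (α - 1)) volume 0 (1/2) := by
    refine (intervalIntegral.intervalIntegrable_rpow' (by linarith : -1 < α - 1)).congr ?_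
    intro x hx
    rw [Set.uIoc_of_le (by norm_num)] at hx
    simp only [abs_of_pos hx.1]
  have h2 := (IntervalIntegrable.iff_comp_neg (by simp)).1 h1
  simp only [abs_neg, neg_zero] at h2
  exact h2.symm.trans h1

lemma aux_bdd_int (f : ℝ → ℝ) (hf : Measurable f) (B : ℝ) (hB : ∀ t, |f t| ≤ B) (a b : ℝ) :
    IntervalIntegrable f volume a b := by
  refine (intervalIntegrable_const (c := B)).mono_fun hf.aestronglyMeasurable ?_
  exact Eventually.of_forall fun t => by
    simpa using (hB t).trans (le_abs_self B)

lemma aux_local (f : ℝ → ℝ) (hf : Measurable f) (B : ℝ) (hB : ∀ t, |f t| ≤ B)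
    (ε α L : ℝ) (hε : 0 < ε) (hα : 0 < α) (hL : 0 ≤ L)
    (h : ∀ t, |t| < ε → |f t - f 0| ≤ L * |t| ^ α) :
    Tendsto (fun N : ℕ => ∫ t in (-(1/2) : ℝ)..(1/2), f t * auxK N (π * t)) atTop (𝓝 (f 0)) := by
  have hB0 : 0 ≤ B := (abs_nonneg _).trans (hB 0)
  obtain ⟨C, hC0, hC⟩ : ∃ C, 0 ≤ C ∧ ∀ t, |f t - f 0| ≤ C * |t| ^ α := by
    refine ⟨L + 2 * B / ε ^ α, by positivity, fun t => ?_⟩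
    have hp : 0 ≤ |t| ^ α := by positivity
    rcases lt_or_ge |t| ε with ht | ht
    · have : 0 ≤ 2 * B / ε ^ α := by positivity
      nlinarith [h t ht, mul_nonneg this hp]
    · have h1 : |f t - f 0| ≤ 2 * B := by
        have := abs_sub (f t) (f 0)
        linarith [hB t, hB 0]
      have h2 : ε ^ α ≤ |t| ^ α := Real.rpow_le_rpow hε.le ht hα.le
      have h3 : 0 < ε ^ α := by positivity
      have h4 : 2 * B ≤ 2 * B / ε ^ α * |t| ^ α := by
        rw [div_mul_eq_mul_div, le_div_iff₀ h3]
        gcongr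
      nlinarith [mul_nonneg hL hp]
  have hsin : ∀ t : ℝ, |t| ≤ 1/2 → 2 * |t| ≤ |Real.sin (π * t)| := by
    intro t ht
    have h1 := Real.mul_le_sin (x := π * |t|) (by positivity) (by nlinarith [Real.pi_pos])
    have h2 : |Real.sin (π * t)| = |Real.sin (π * |t|)| := by
      rcases abs_cases t with ⟨h, _⟩ | ⟨h, _⟩ <;> rw [h]
      rw [mul_neg, Real.sin_neg, abs_neg]
    rw [h2]
    refine le_trans (le_of_eq ?_) (h1.trans (le_abs_self _))
    field_simp
  set q : ℝ → ℝ := fun t => (f t - f 0) * Real.cos (π * t) / Real.sin (π * t) with hq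
  have hqi : IntervalIntegrable q volume (-(1/2)) (1/2) := by
    refine ((aux_abs_rpow α hα).const_mul C).mono_fun ?_ ?_
    · exact Measurable.aestronglyMeasurable (by fun_prop)
    · refine (ae_restrict_iff' measurableSet_uIoc).2 (Eventually.of_forall fun t ht => ?_)
      rw [Set.uIoc_of_le (by norm_num)] at ht
      have hta : |t| ≤ 1/2 := abs_le.2 ⟨ht.1.le, ht.2⟩
      have hs := hsin t hta
      rcases eq_or_ne t 0 with rfl | ht0
      · simp [hq]; positivity
      have htp : 0 < |t| := abs_pos.2 ht0
      simp only [hq, Real.norm_eq_abs, abs_div, abs_mul]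
      rw [abs_of_nonneg hC0, abs_of_nonneg (by positivity : 0 ≤ |t| ^ (α - 1)),
        div_le_iff₀ (by linarith)]
      have e : |t| ^ α = |t| ^ (α - 1) * |t| := by
        rw [Real.rpow_sub_one htp.ne']; field_simp
      calc |f t - f 0| * |Real.cos (π * t)| ≤ |f t - f 0| * 1 := by
            gcongr; exact Real.abs_cos_le_one _
        _ ≤ C * |t| ^ α := by rw [mul_one]; exact hC t
        _ = C * |t| ^ (α - 1) * |t| := by rw [e]; ring
        _ ≤ _ := by
            apply mul_le_mul_of_nonneg_left (by linarith) (by positivity)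
  have hRL := (aux_RL q _ _ (by norm_num) hqi).comp
    ((tendsto_natCast_atTop_atTop (R := ℝ)).const_mul_atTop (by norm_num : (0:ℝ) < 2))
  have := hRL.const_add (f 0)
  rw [add_zero] at this
  refine this.congr' ?_
  filter_upwards [eventually_ge_atTop 1] with N hN
  have e1 : ∫ t in (-(1/2) : ℝ)..(1/2), q t * Real.sin (π * (2 * (N:ℝ)) * t)
      = ∫ t in (-(1/2) : ℝ)..(1/2), (f t - f 0) * auxK N (π * t) := by
    refine intervalIntegral.integral_congr fun t ht => ?_
    rw [Set.uIcc_of_le (by norm_num)] at ht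
    have hs := hsin t (abs_le.2 ⟨ht.1, ht.2⟩)
    rcases eq_or_ne t 0 with rfl | ht0
    · simp
    have htp : 0 < |t| := abs_pos.2 ht0
    have hne : Real.sin (π * t) ≠ 0 := abs_pos.1 (by linarith)
    have hk := auxK_sin N (π * t)
    simp only [hq]
    rw [div_mul_eq_mul_div, div_eq_iff hne, mul_assoc (f t - f 0) (auxK N _), hk]
    ring_nf
  simp only [Function.comp]
  rw [e1]
  have hKc : Continuous fun t => auxK N (π * t) := (auxK_cont N).comp (by fun_prop)
  have hfi := aux_bdd_int f hf B hB (-(1/2)) (1/2)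
  have e2 : ∀ t, (f t - f 0) * auxK N (π * t) = f t * auxK N (π * t) - f 0 * auxK N (π * t) :=
    fun t => by ring
  simp only [e2]
  rw [intervalIntegral.integral_sub (hfi.mul_continuousOn hKc.continuousOn)
    ((hKc.intervalIntegrable _ _).const_mul _), intervalIntegral.integral_const_mul,
    auxK_integral N hN]
  ring

lemma auxK_periodic (N l : ℕ) (b : ℝ) : auxK N (π * l + b) = auxK N b := by
  unfold auxK
  refine Finset.sum_congr rfl fun j _ => ?_
  congr 1
  · rw [show 2 * (π * l + b) * ((j:ℝ)+1) = 2 * b * (j+1) + ((l * (j+1) : ℕ) : ℝ) * (2 * π) by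
      push_cast; ring, Real.cos_add_nat_mul_two_pi]
  · rw [show 2 * (π * l + b) * (j:ℝ) = 2 * b * j + ((l * j : ℕ) : ℝ) * (2 * π) by
      push_cast; ring, Real.cos_add_nat_mul_two_pi]

lemma aux_cells (M : ℕ) (hM : 0 < M) (G : ℝ → ℝ) (hG : Measurable G) (B : ℝ)
    (hB : ∀ y, |G y| ≤ B) (hG0 : ∀ y, y ∉ Set.Icc (0:ℝ) 1 → G y = 0)
    (hH : ∀ l ≤ M, ∃ ε > 0, ∃ α > 0, ∃ L ≥ 0, ∀ t, |t| < ε →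
      |G ((l + t) / M) - G (l / M)| ≤ L * |t| ^ (α:ℝ)) :
    Tendsto (fun N : ℕ => ∫ y in (0:ℝ)..1, G y * auxK N (π * M * y)) atTop
      (𝓝 (∑ l ∈ Finset.range (M + 1), (1 / (M:ℝ)) * G (l / M))) := by
  have hM' : (0:ℝ) < M := by exact_mod_cast hM
  have h1 : Tendsto (fun N : ℕ => ∑ l ∈ Finset.range (M + 1),
      (1 / (M:ℝ)) * ∫ t in (-(1/2):ℝ)..(1/2), G ((l + t) / M) * auxK N (π * t)) atTop
      (𝓝 (∑ l ∈ Finset.range (M + 1), (1 / (M:ℝ)) * G (l / M))) := by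
    refine tendsto_finsetSum _ fun l hl => Tendsto.const_mul _ ?_
    obtain ⟨ε, hε, α, hα, L, hL, h⟩ := hH l (by simpa [Nat.lt_succ_iff] using hl)
    have := aux_local (fun t => G ((l + t) / M)) (by fun_prop) B (fun t => hB _) ε α L hε hα hL
      (by simpa using h)
    simpa using this
  refine h1.congr fun N => ?_
  have hKc : Continuous fun y => auxK N (π * M * y) := (auxK_cont N).comp (by fun_prop)
  have hint : ∀ a b, IntervalIntegrable (fun y => G y * auxK N (π * M * y)) volume a b := fun a b =>
    (aux_bdd_int G hG B hB a b).mul_continuousOn hKc.continuousOn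
  have h2 := intervalIntegral.sum_integral_adjacent_intervals (μ := volume)
    (f := fun y => G y * auxK N (π * M * y))
    (a := fun l : ℕ => ((l:ℝ) - 1/2) / M) (n := M + 1) (fun l _ => hint _ _)
  have h3 : ∀ l : ℕ, ∫ y in (((l:ℝ) - 1/2) / M)..((((l+1 : ℕ):ℝ) - 1/2) / M), G y * auxK N (π * M * y)
      = (1 / (M:ℝ)) * ∫ t in (-(1/2):ℝ)..(1/2), G ((l + t) / M) * auxK N (π * t) := by
    intro l
    have := intervalIntegral.integral_comp_add_div (a := -(1/2)) (b := 1/2)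
      (fun y => G y * auxK N (π * M * y)) hM'.ne' ((l:ℝ) / M)
    have e : ∀ t : ℝ, G ((l + t) / M) * auxK N (π * t)
        = G ((l:ℝ) / M + t / M) * auxK N (π * M * ((l:ℝ) / M + t / M)) := by
      intro t
      rw [show π * M * ((l:ℝ) / M + t / M) = π * l + π * t by field_simp, auxK_periodic, add_div]
    simp only [e]
    rw [this, smul_eq_mul, ← mul_assoc, one_div_mul_cancel hM'.ne', one_mul]
    congr 1
    · ring
    · push_cast; ring
  simp only [h3] at h2
  rw [h2]
  have z1 : ∫ y in (((0:ℕ):ℝ) - 1/2) / M..0, G y * auxK N (π * M * y) = 0 := by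
    rw [intervalIntegral.integral_of_le (by
      rw [div_le_iff₀ hM']; norm_num), integral_Ioc_eq_integral_Ioo]
    refine setIntegral_eq_zero_of_forall_eq_zero fun y hy => ?_
    rw [hG0 y (fun h => absurd hy.2 (not_lt.2 h.1)), zero_mul]
  have z2 : ∫ y in (1:ℝ)..(((M+1:ℕ):ℝ) - 1/2) / M, G y * auxK N (π * M * y) = 0 := by
    rw [intervalIntegral.integral_of_le (by
      rw [le_div_iff₀ hM']; push_cast; linarith)]
    refine setIntegral_eq_zero_of_forall_eq_zero fun y hy => ?_
    rw [hG0 y (fun h => absurd hy.1 (not_lt.2 h.2)), zero_mul]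
  rw [← intervalIntegral.integral_add_adjacent_intervals (hint _ 0) (hint 0 _), z1,
    ← intervalIntegral.integral_add_adjacent_intervals (hint 0 1) (hint 1 _), z2]
  ring

/-- Aliasing formula: if `H : [0,1] → ℝ` is bounded, measurable and Hölder continuous in a
neighbourhood of every interior grid point `y_k = k/M`, then for every `k ∈ {1,…,M−1}` the
series `H_k = ∑_l (𝟙_{I_k^+}(l) − 𝟙_{I_k^-}(l)) h_l` converges, with limit the discrete
inner product `⟨H, e_k⟩_M`, where `I_k^+ = {k + 2Mj : j ∈ ℕ₀}`, `I_k^- = {2M−k+2Mj : j ∈ ℕ₀}`. -/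
theorem aliasing_formula (M : ℕ) (hM : 2 ≤ M) (H : ℝ → ℝ)
    (hmeas : Measurable H)
    (hbdd : ∃ B : ℝ, ∀ x ∈ Set.Icc (0 : ℝ) 1, |H x| ≤ B)
    (hHolder : ∀ k ∈ Finset.Icc 1 (M - 1), ∃ ε > (0 : ℝ), ∃ α ∈ Set.Ioc (0 : ℝ) 1,
      ∃ L ≥ (0 : ℝ),
        ∀ x ∈ Set.Ioo ((k : ℝ) / M - ε) ((k : ℝ) / M + ε) ∩ Set.Icc (0 : ℝ) 1,
        ∀ y ∈ Set.Ioo ((k : ℝ) / M - ε) ((k : ℝ) / M + ε) ∩ Set.Icc (0 : ℝ) 1,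
          |H x - H y| ≤ L * |x - y| ^ α)
    (k : ℕ) (hk : k ∈ Finset.Icc 1 (M - 1)) :
    Tendsto (fun n => ∑ l ∈ Finset.Icc 1 n,
        (Set.indicator {l : ℕ | ∃ j : ℕ, l = k + 2 * M * j} (fun _ => (1 : ℝ)) l
          - Set.indicator {l : ℕ | ∃ j : ℕ, l = 2 * M - k + 2 * M * j} (fun _ => (1 : ℝ)) l)
          * fourierSineCoef H l)
      atTop (𝓝 (discIP M H k)) := by
  classical
  obtain ⟨B, hB⟩ := hbdd
  obtain ⟨hk1, hk2⟩ := Finset.mem_Icc.1 hk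
  have hM' : (0:ℝ) < M := by exact_mod_cast (by omega : 0 < M)
  have hB0 : 0 ≤ B := (abs_nonneg _).trans (hB 0 (by simp))
  set H1 : ℝ → ℝ := (Set.Icc (0:ℝ) 1).indicator H with hH1
  have hH1m : Measurable H1 := hmeas.indicator measurableSet_Icc
  have hH1e : ∀ y ∈ Set.Icc (0:ℝ) 1, H1 y = H y := fun y hy => Set.indicator_of_mem hy H
  have hH1b : ∀ y, |H1 y| ≤ B := by
    intro y
    by_cases hy : y ∈ Set.Icc (0:ℝ) 1
    · rw [hH1e y hy]; exact hB y hy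
    · rw [hH1, Set.indicator_of_notMem hy]; simpa using hB0
  have hcoef : ∀ l, fourierSineCoef H l = ∫ y in (0:ℝ)..1, H1 y * sineB l y := by
    intro l
    refine intervalIntegral.integral_congr fun y hy => ?_
    rw [Set.uIcc_of_le (by norm_num)] at hy
    simp only [hH1e y hy]
  have hH1i := aux_bdd_int H1 hH1m B hH1b 0 1
  have hsc : ∀ l, Continuous (sineB l) := fun l => by unfold sineB; fun_prop
  -- coefficients tend to zero
  have hh0 : Tendsto (fourierSineCoef H) atTop (𝓝 0) := by
    have := (aux_RL (fun y => H1 y * √2) 0 1 (by norm_num) (hH1i.mul_const _)).comp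
      (tendsto_natCast_atTop_atTop (R := ℝ))
    refine this.congr fun l => ?_
    rw [hcoef]
    simp only [Function.comp, sineB, mul_assoc]
  set u : ℕ → ℝ := fun l =>
    (Set.indicator {l : ℕ | ∃ j : ℕ, l = k + 2 * M * j} (fun _ => (1 : ℝ)) l
          - Set.indicator {l : ℕ | ∃ j : ℕ, l = 2 * M - k + 2 * M * j} (fun _ => (1 : ℝ)) l)
          * fourierSineCoef H l with hu
  have hu0 : Tendsto u atTop (𝓝 0) := by
    have h2 : Tendsto (fun l => 2 * |fourierSineCoef H l|) atTop (𝓝 0) := by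
      simpa using hh0.abs.const_mul 2
    refine squeeze_zero_norm (fun l => ?_) h2
    simp only [hu, norm_mul, Real.norm_eq_abs]
    gcongr
    simp only [Set.indicator_apply]
    split_ifs <;> norm_num
  -- block sums
  have hblock : ∀ N, ∑ l ∈ Finset.range (2 * M * N), u l = ∑ j ∈ Finset.range N,
      (fourierSineCoef H (k + 2 * M * j) - fourierSineCoef H (2 * M - k + 2 * M * j)) := by
    intro N
    induction N with
    | zero => simp
    | succ n ih =>
      rw [mul_add, mul_one, Finset.sum_range_add, ih, Finset.sum_range_succ]
      congr 1
      have e1 : ∀ r ∈ Finset.range (2 * M), u (2 * M * n + r)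
          = (if r = k then fourierSineCoef H (2 * M * n + r) else 0)
            - (if r = 2 * M - k then fourierSineCoef H (2 * M * n + r) else 0) := by
        intro r hr
        have hr := Finset.mem_range.1 hr
        have key : ∀ c < 2 * M, (∃ j : ℕ, 2 * M * n + r = c + 2 * M * j) ↔ r = c := by
          intro c hc
          constructor
          · rintro ⟨j, hj⟩
            have h1 := congrArg (· % (2 * M)) hj
            simpa [Nat.mul_add_mod, Nat.add_mul_mod_self_left, Nat.mod_eq_of_lt hr,
              Nat.mod_eq_of_lt hc] using h1
          · rintro rfl; exact ⟨n, by ring⟩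
        simp only [hu, Set.indicator_apply, Set.mem_ofPred_eq, key k (by omega),
          key (2 * M - k) (by omega)]
        split_ifs <;> simp
      rw [Finset.sum_congr rfl e1, Finset.sum_sub_distrib, Finset.sum_ite_eq', Finset.sum_ite_eq',
        if_pos (Finset.mem_range.2 (by omega)), if_pos (Finset.mem_range.2 (by omega)),
        add_comm k, add_comm (2 * M - k)]
  have hkM : k ≤ 2 * M := by omega
  set G : ℝ → ℝ := fun y => H1 y * sineB k y with hG
  have hsb : ∀ y, |sineB k y| ≤ √2 := by
    intro y
    rw [sineB, abs_mul, abs_of_nonneg (Real.sqrt_nonneg 2)]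
    exact mul_le_of_le_one_right (Real.sqrt_nonneg 2) (Real.abs_sin_le_one _)
  have hGm : Measurable G := hH1m.mul (hsc k).measurable
  have hGb : ∀ y, |G y| ≤ B * √2 := by
    intro y
    simp only [hG, abs_mul]
    exact mul_le_mul (hH1b y) (hsb y) (abs_nonneg _) hB0
  have hsl : ∀ x y, |sineB k x - sineB k y| ≤ √2 * (π * k) * |x - y| := by
    intro x y
    rw [sineB, sineB, ← mul_sub, abs_mul, abs_of_nonneg (Real.sqrt_nonneg 2), mul_assoc √2]
    refine mul_le_mul_of_nonneg_left ?_ (Real.sqrt_nonneg 2)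
    refine (Real.abs_sin_sub_sin_le _ _).trans (le_of_eq ?_)
    rw [← mul_sub, abs_mul, abs_of_nonneg (by positivity : 0 ≤ π * k)]
  have hs0 : sineB k (((0:ℕ):ℝ) / M) = 0 := by simp [sineB]
  have hsM : sineB k ((M:ℝ) / M) = 0 := by
    rw [div_self hM'.ne', sineB, mul_one, mul_comm π, Real.sin_nat_mul_pi, mul_zero]
  have hdiff : ∀ (l : ℕ) (t : ℝ), ((l:ℝ) + t) / M - l / M = t / M := by intro l t; ring
  have htM : ∀ t : ℝ, |t / M| ≤ |t| := by
    intro t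
    rw [abs_div, abs_of_pos hM']
    exact div_le_self (abs_nonneg _) (by exact_mod_cast (by omega : 1 ≤ M))
  have hcell : ∀ l ≤ M, ∃ ε > 0, ∃ α > 0, ∃ L ≥ 0, ∀ t, |t| < ε →
      |G ((l + t) / M) - G (l / M)| ≤ L * |t| ^ (α:ℝ) := by
    intro l hl
    have hsecond : ∀ t : ℝ, |H1 ((l + t) / M) * (sineB k ((l + t) / M) - sineB k (l / M))|
        ≤ B * (√2 * (π * k)) * |t| := by
      intro t
      rw [abs_mul, mul_assoc B]
      refine mul_le_mul (hH1b _) ((hsl _ _).trans ?_) (abs_nonneg _) hB0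
      rw [hdiff]
      exact mul_le_mul_of_nonneg_left (htM t) (by positivity)
    have hsplit : ∀ t : ℝ, G ((l + t) / M) - G (l / M) =
        (H1 ((l + t) / M) - H1 (l / M)) * sineB k (l / M)
        + H1 ((l + t) / M) * (sineB k ((l + t) / M) - sineB k (l / M)) := by
      intro t; simp only [hG]; ring
    by_cases hend : l = 0 ∨ l = M
    · have hz : sineB k ((l:ℝ) / M) = 0 := by
        rcases hend with rfl | rfl
        · exact hs0
        · exact hsM
      refine ⟨1, one_pos, 1, one_pos, B * (√2 * (π * k)), by positivity, fun t _ => ?_⟩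
      rw [Real.rpow_one, hsplit, hz, mul_zero, zero_add, ← hz]
      exact hsecond t
    · have hl1 : 1 ≤ l := by omega
      have hl2 : l + 1 ≤ M := by omega
      have hl1' : (1:ℝ) ≤ l := by exact_mod_cast hl1
      have hl2' : (l:ℝ) + 1 ≤ M := by exact_mod_cast hl2
      obtain ⟨ε, hε, α, ⟨hα0, hα1⟩, L, hL, h⟩ := hHolder l (Finset.mem_Icc.2 ⟨hl1, by omega⟩)
      refine ⟨min ε 1, by positivity, α, hα0, L * √2 + B * (√2 * (π * k)), by positivity,
        fun t ht => ?_⟩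
      have htε := ht.trans_le (min_le_left _ _)
      have ht1 := (ht.trans_le (min_le_right _ _)).le
      obtain ⟨ht1a, ht1b⟩ := abs_le.1 ht1
      have hx : ((l:ℝ) + t) / M ∈ Set.Icc (0:ℝ) 1 :=
        ⟨div_nonneg (by linarith) hM'.le, (div_le_one hM').2 (by linarith)⟩
      have hy : (l:ℝ) / M ∈ Set.Icc (0:ℝ) 1 :=
        ⟨by positivity, (div_le_one hM').2 (by linarith)⟩
      have hd := abs_lt.1 ((htM t).trans_lt htε)
      have hh := h (((l:ℝ) + t) / M) ⟨⟨by linarith [hdiff l t], by linarith [hdiff l t]⟩, hx⟩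
        ((l:ℝ) / M) ⟨⟨by linarith, by linarith⟩, hy⟩
      rw [hdiff] at hh
      have hp : |t / M| ^ α ≤ |t| ^ α := Real.rpow_le_rpow (abs_nonneg _) (htM t) hα0.le
      have hp1 : |t| ≤ |t| ^ α := by
        rcases (abs_nonneg t).eq_or_lt with h0 | h0
        · rw [← h0]; positivity
        · calc |t| = |t| ^ (1:ℝ) := (Real.rpow_one _).symm
            _ ≤ |t| ^ α := Real.rpow_le_rpow_of_exponent_ge h0 ht1 hα1
      rw [hsplit, add_mul]
      refine (abs_add_le _ _).trans (add_le_add ?_ ((hsecond t).trans ?_))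
      · rw [abs_mul, hH1e _ hx, hH1e _ hy]
        calc _ ≤ (L * |t| ^ α) * √2 :=
              mul_le_mul (hh.trans (by gcongr)) (hsb _) (abs_nonneg _) (by positivity)
          _ = _ := by ring
      · gcongr
  have hmain := aux_cells M (by omega) G hGm _ hGb
    (fun y hy => by simp only [hG, hH1, Set.indicator_of_notMem hy, zero_mul]) hcell
  have hval : ∑ l ∈ Finset.range (M + 1), (1 / (M:ℝ)) * G (l / M) = discIP M H k := by
    rw [discIP, ← Finset.mul_sum]
    congr 1
    symm
    have hsub : Finset.Icc 1 (M - 1) ⊆ Finset.range (M + 1) := by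
      intro l hl
      rw [Finset.mem_Icc] at hl
      exact Finset.mem_range.2 (by omega)
    have e : ∑ l ∈ Finset.Icc 1 (M - 1), H ((l:ℝ) / M) * sineB k ((l:ℝ) / M)
        = ∑ l ∈ Finset.Icc 1 (M - 1), G ((l:ℝ) / M) := by
      refine Finset.sum_congr rfl fun l hl => ?_
      rw [Finset.mem_Icc] at hl
      have : (l:ℝ) ≤ M := by exact_mod_cast (by omega : l ≤ M)
      simp only [hG]
      rw [hH1e _ ⟨by positivity, (div_le_one hM').2 this⟩]
    rw [e]
    refine Finset.sum_subset hsub fun l hl hl' => ?_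
    rw [Finset.mem_range] at hl
    rw [Finset.mem_Icc] at hl'
    have : l = 0 ∨ l = M := by omega
    simp only [hG]
    rcases this with rfl | rfl
    · rw [hs0, mul_zero]
    · rw [hsM, mul_zero]
  rw [hval] at hmain
  have hrem := (aux_RL (fun y => H1 y * (√2 * Real.cos (π * k * y))) 0 1 (by norm_num)
    (hH1i.mul_continuousOn (by fun_prop))).comp
      ((tendsto_natCast_atTop_atTop (R := ℝ)).const_mul_atTop (by positivity : (0:ℝ) < 2 * M))
  have hlim := hmain.sub hrem
  rw [sub_zero] at hlim
  have hP : Tendsto (fun N => ∑ l ∈ Finset.range (2 * M * N), u l) atTop (𝓝 (discIP M H k)) := by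
    refine hlim.congr fun N => ?_
    rw [hblock]
    have hKc : Continuous fun y => auxK N (π * M * y) := (auxK_cont N).comp (by fun_prop)
    have hi : ∀ l, IntervalIntegrable (fun y => H1 y * sineB l y) volume 0 1 := fun l =>
      hH1i.mul_continuousOn (hsc l).continuousOn
    simp only [hcoef, Function.comp]
    rw [← intervalIntegral.integral_sub]
    · have e : ∀ j ∈ Finset.range N, (∫ y in (0:ℝ)..1, H1 y * sineB (k + 2 * M * j) y)
          - (∫ y in (0:ℝ)..1, H1 y * sineB (2 * M - k + 2 * M * j) y)
          = ∫ y in (0:ℝ)..1, (H1 y * sineB (k + 2 * M * j) y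
            - H1 y * sineB (2 * M - k + 2 * M * j) y) := fun j _ =>
        (intervalIntegral.integral_sub (hi _) (hi _)).symm
      rw [Finset.sum_congr rfl e, ← intervalIntegral.integral_finsetSum
        (fun j _ => (hi _).sub (hi _))]
      congr 1
      ext y
      have hS := auxS N (π * k * y) (π * M * y)
      have e2 : ∀ j ∈ Finset.range N, H1 y * sineB (k + 2 * M * j) y
            - H1 y * sineB (2 * M - k + 2 * M * j) y = H1 y * √2 *
            (Real.sin (π * k * y + 2 * (π * M * y) * j)
              - Real.sin (2 * (π * M * y) - π * k * y + 2 * (π * M * y) * j)) := by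
        intro j _
        simp only [sineB]
        push_cast [Nat.cast_sub hkM]
        rw [show π * ((k:ℝ) + 2 * M * j) * y = π * k * y + 2 * (π * M * y) * j by ring,
          show π * (2 * (M:ℝ) - k + 2 * M * j) * y
            = 2 * (π * M * y) - π * k * y + 2 * (π * M * y) * j by ring]
        ring
      rw [Finset.sum_congr rfl e2, ← Finset.mul_sum, hS]
      simp only [hG, sineB]
      rw [show π * (2 * (M:ℝ) * N) * y = 2 * (π * M * y) * N by ring]
      ring
    · exact (hi k).mul_continuousOn hKc.continuousOn
    · exact (hH1i.mul_continuousOn (by fun_prop)).mul_continuousOn (by fun_prop)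
  have hfin := (aux_subseq (2 * M) (by omega) u _ hu0 hP).comp (tendsto_add_atTop_nat 1)
  refine hfin.congr fun n => ?_
  simp only [Function.comp]
  rw [Finset.sum_range_succ']
  have hz : u 0 = 0 := by
    have : fourierSineCoef H 0 = 0 := by simp [fourierSineCoef, sineB]
    simp only [hu, this, mul_zero]
  rw [hz, add_zero, Finset.range_eq_Ico, Finset.sum_Ico_add' u 0 n 1]
  rfl
end

section
/- Let α ∈ (0, 1/2) and ϑ > 0. There exists a constant C > 0, depending only on α and ϑ, with the following property: for every integer M ≥ 2 and every continuous H : [0,1] → ℝ and K ≥ 0 such that (a) sup_{x∈[0,1]} |H(x)| ≤ K, (b) |H(x) − H(y)| ≤ K|x − y|^{2α} for all x, y ∈ [0,1], and (c) ∑_{ℓ=1}^{∞} (ϑπ²ℓ²)^{2α} h_ℓ² ≤ K², one has ∫₀¹ (H(x) − H^M(x))² dx ≤ C·K²·M^{−8α²/(4α+1)}, where H^M := ∑_{k=1}^{M−1} ⟨H, e_k⟩_M e_k. -/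
open Real

/-- The trigonometric interpolation polynomial `H^M = ∑_{k=1}^{M−1} ⟨H, e_k⟩_M e_k`. -/
noncomputable def trigPoly (M : ℕ) (H : ℝ → ℝ) (x : ℝ) : ℝ :=
  ∑ k ∈ Finset.Icc 1 (M - 1), discIP M H k * sineB k x

open MeasureTheory intervalIntegral in
lemma aux_fold (φ : ℝ → ℂ) (h : IntervalIntegrable φ volume (-1) 1) :
    ∫ x in (-1:ℝ)..1, φ x = ∫ x in (0:ℝ)..1, (φ x + φ (-x)) := by
  have h1 : IntervalIntegrable φ volume (-1) 0 := h.mono_set (by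
    rw [Set.uIcc_of_le (by norm_num), Set.uIcc_of_le (by norm_num)]
    exact Set.Icc_subset_Icc le_rfl (by norm_num))
  have h2 : IntervalIntegrable φ volume 0 1 := h.mono_set (by
    rw [Set.uIcc_of_le (by norm_num), Set.uIcc_of_le (by norm_num)]
    exact Set.Icc_subset_Icc (by norm_num) le_rfl)
  have h3 : IntervalIntegrable (fun x => φ (-x)) volume 0 1 := by
    have := h1.comp_sub_left 0
    simpa using this.symm
  rw [integral_add h2 h3, integral_comp_neg, ← integral_add_adjacent_intervals h1 h2]
  simp [add_comm]

noncomputable def auxF (H : ℝ → ℝ) (x : ℝ) : ℂ := if 0 < x then (H x : ℂ) else -(H (-x) : ℂ)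

lemma auxF_meas (H : ℝ → ℝ) (hH : Continuous H) : Measurable (auxF H) := by
  unfold auxF
  refine Measurable.ite measurableSet_Ioi ?_ ?_
  · exact (Complex.continuous_ofReal.comp hH).measurable
  · exact (Complex.continuous_ofReal.comp (hH.comp continuous_neg)).measurable.neg

lemma auxF_bound (H : ℝ → ℝ) (hH : Continuous H) :
    ∃ B, ∀ x ∈ Set.Ioc (-1:ℝ) 1, ‖auxF H x‖ ≤ B := by
  obtain ⟨B, hB⟩ := (isCompact_Icc (a := (-1:ℝ)) (b := 1)).exists_bound_of_continuousOn
    hH.continuousOn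
  refine ⟨B, fun x hx => ?_⟩
  unfold auxF
  split_ifs
  · simpa using hB x ⟨hx.1.le, hx.2⟩
  · simpa using hB (-x) ⟨by linarith [hx.2], by linarith [hx.1]⟩

open MeasureTheory in
lemma auxF_memLp (H : ℝ → ℝ) (hH : Continuous H) (p : ENNReal) :
    MemLp (auxF H) p (volume.restrict (Set.Ioc (-1:ℝ) 1)) := by
  obtain ⟨B, hB⟩ := auxF_bound H hH
  refine MemLp.of_bound (auxF_meas H hH).aestronglyMeasurable B ?_
  exact (ae_restrict_iff' measurableSet_Ioc).2 (Filter.Eventually.of_forall hB)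

open MeasureTheory intervalIntegral in
lemma auxF_coef (H : ℝ → ℝ) (hH : Continuous H) (n : ℤ) :
    fourierCoeffOn (by norm_num : (-1:ℝ) < 1) (auxF H) n
      = -Complex.I * ((∫ x in (0:ℝ)..1, H x * Real.sin (π * n * x) : ℝ) : ℂ) := by
  rw [fourierCoeffOn_eq_integral, aux_fold]
  · rw [← intervalIntegral.integral_ofReal, ← intervalIntegral.integral_const_mul,
      ← intervalIntegral.integral_smul]
    refine integral_congr_ae (Filter.Eventually.of_forall fun x hx => ?_)
    rw [Set.uIoc_of_le (by norm_num)] at hx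
    have e1 : auxF H x = H x := by simp [auxF, hx.1]
    have e2 : auxF H (-x) = - H x := by simp [auxF, hx.1.le]
    rw [e1, e2, fourier_coe_apply, fourier_coe_apply]
    push_cast
    rw [Complex.sin]
    have a1 : 2 * (π:ℂ) * Complex.I * -(n:ℂ) * (x:ℂ) / (1 - -1) = -(π * n * x : ℂ) * Complex.I := by
      ring
    have a2 : 2 * (π:ℂ) * Complex.I * -(n:ℂ) * (-(x:ℂ)) / (1 - -1) = (π * n * x : ℂ) * Complex.I := by
      ring
    rw [a1, a2]
    simp only [smul_eq_mul, Complex.real_smul]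
    push_cast
    linear_combination (1/2) * (H x : ℂ) * (Complex.exp (-(π * n * x : ℂ) * Complex.I)- Complex.exp ((π * n * x : ℂ) * Complex.I)) * Complex.I_sq
  · rw [intervalIntegrable_iff_integrableOn_Ioc_of_le (by norm_num)]
    have h1 := (auxF_memLp H hH 1).integrable le_rfl
    refine h1.bdd_mul (c := 1) ?_ ?_
    · exact ((map_continuous (fourier (-n))).comp
        (AddCircle.continuous_mk' _)).aestronglyMeasurable
    · exact Filter.Eventually.of_forall fun x => by
        rw [fourier_apply]; exact le_of_eq (Circle.norm_coe _)

open MeasureTheory intervalIntegral in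
lemma parseval_cont (H : ℝ → ℝ) (hH : Continuous H) :
    HasSum (fun ℓ : ℕ => fourierSineCoef H (ℓ + 1) ^ 2) (∫ x in (0:ℝ)..1, H x ^ 2) := by
  have key := hasSum_sq_fourierCoeffOn (by norm_num : (-1:ℝ) < 1) (auxF_memLp H hH 2)
  have hI : ((1 - -1 : ℝ))⁻¹ • ∫ x in (-1:ℝ)..1, ‖auxF H x‖ ^ 2 = ∫ x in (0:ℝ)..1, H x ^ 2 := by
    have hm := (auxF_memLp H hH 2)
    have h1 : IntervalIntegrable (fun x => ((‖auxF H x‖ ^ 2 : ℝ) : ℂ)) volume (-1) 1 := by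
      rw [intervalIntegrable_iff_integrableOn_Ioc_of_le (by norm_num)]
      exact (hm.integrable_norm_pow (by norm_num)).ofReal
    have := aux_fold _ h1
    have h2 : ∫ x in (0:ℝ)..1, (((‖auxF H x‖ ^ 2 : ℝ) : ℂ) + ((‖auxF H (-x)‖ ^ 2 : ℝ) : ℂ))
        = ∫ x in (0:ℝ)..1, ((2 * H x ^ 2 : ℝ) : ℂ) := by
      refine integral_congr_ae (Filter.Eventually.of_forall fun x hx => ?_)
      rw [Set.uIoc_of_le (by norm_num)] at hx
      have e1 : auxF H x = H x := by simp [auxF, hx.1]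
      have e2 : auxF H (-x) = - H x := by simp [auxF, hx.1.le]
      rw [e1, e2]
      simp [two_mul]
    rw [h2, intervalIntegral.integral_ofReal, intervalIntegral.integral_ofReal] at this
    have := Complex.ofReal_injective this
    rw [this, intervalIntegral.integral_const_mul]
    rw [smul_eq_mul]; ring
  rw [hI] at key
  have h2 := key.nat_add_neg
  have hz : ‖fourierCoeffOn (by norm_num : (-1:ℝ) < 1) (auxF H) 0‖ ^ 2 = 0 := by
    rw [auxF_coef H hH]; simp
  rw [hz, add_zero] at h2
  rw [← hasSum_nat_add_iff' 1] at h2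
  have e0 : (∫ x in (0:ℝ)..1, H x ^ 2) - ∑ i ∈ Finset.range 1,
      (‖fourierCoeffOn (by norm_num : (-1:ℝ) < 1) (auxF H) (i : ℤ)‖ ^ 2
        + ‖fourierCoeffOn (by norm_num : (-1:ℝ) < 1) (auxF H) (-(i : ℤ))‖ ^ 2)
      = ∫ x in (0:ℝ)..1, H x ^ 2 := by
    simp only [Finset.sum_range_one, Nat.cast_zero, neg_zero, hz]; ring
  rw [e0] at h2
  have hfe : (fun ℓ : ℕ => fourierSineCoef H (ℓ + 1) ^ 2) = fun n : ℕ =>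
      ‖fourierCoeffOn (by norm_num : (-1:ℝ) < 1) (auxF H) ((n + 1 : ℕ) : ℤ)‖ ^ 2
        + ‖fourierCoeffOn (by norm_num : (-1:ℝ) < 1) (auxF H) (-((n + 1 : ℕ) : ℤ))‖ ^ 2 := by
    funext l
    rw [auxF_coef H hH, auxF_coef H hH]
    have : fourierSineCoef H (l+1)
        = √2 * ∫ x in (0:ℝ)..1, H x * Real.sin (π * ((l + 1 : ℕ) : ℤ) * x) := by
      unfold fourierSineCoef sineB
      rw [← intervalIntegral.integral_const_mul]
      congr 1; funext x; push_cast; ring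
    have h' : ∫ x in (0:ℝ)..1, H x * Real.sin (π * ((-((l + 1 : ℕ) : ℤ) : ℤ) : ℝ) * x)
      = - ∫ x in (0:ℝ)..1, H x * Real.sin (π * ((l + 1 : ℕ) : ℤ) * x) := by
      rw [← intervalIntegral.integral_neg]
      congr 1; funext x; rw [← mul_neg, ← Real.sin_neg]; push_cast; ring_nf
    rw [this, h', mul_pow, Real.sq_sqrt (by norm_num)]
    simp only [norm_mul, norm_neg, Complex.norm_I, one_mul, Complex.norm_real, Real.norm_eq_abs,
      abs_neg, sq_abs]
    ring
  rw [hfe]; exact h2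

lemma parseval (H : ℝ → ℝ) (hH : ContinuousOn H (Set.Icc 0 1)) :
    HasSum (fun ℓ : ℕ => fourierSineCoef H (ℓ + 1) ^ 2) (∫ x in (0:ℝ)..1, H x ^ 2) := by
  set G : ℝ → ℝ := Set.IccExtend (zero_le_one (α := ℝ)) ((Set.Icc (0:ℝ) 1).domRestrict H) with hG
  have hGc : Continuous G := (continuousOn_iff_continuous_domRestrict.1 hH).Icc_extend'
  have e : ∀ x ∈ Set.uIcc (0:ℝ) 1, H x = G x := by
    intro x hx
    rw [Set.uIcc_of_le (by norm_num)] at hx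
    rw [hG, Set.IccExtend_of_mem _ _ hx]; rfl
  have h := parseval_cont G hGc
  have e1 : ∫ x in (0:ℝ)..1, G x ^ 2 = ∫ x in (0:ℝ)..1, H x ^ 2 :=
    intervalIntegral.integral_congr fun x hx => by simp only [e x hx]
  have e2 : ∀ l, fourierSineCoef G l = fourierSineCoef H l := fun l =>
    intervalIntegral.integral_congr fun x hx => by simp only [e x hx]
  simpa only [e1, e2] using h

lemma cos_sum_aux (θ : ℝ) (M : ℕ) :
    (∑ l ∈ Finset.range M, Real.cos (θ * l)) * (2 * Real.sin (θ / 2))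
      = Real.sin (θ * M - θ / 2) + Real.sin (θ / 2) := by
  induction M with
  | zero => simp
  | succ n ih =>
    rw [Finset.sum_range_succ, add_mul, ih]
    have : Real.sin (θ * (n + 1 : ℕ) - θ / 2) = Real.sin (θ * n + θ / 2) := by
      push_cast; ring_nf
    rw [this, Real.sin_add, Real.sin_sub]; ring

lemma cos_sum (m : ℤ) (M : ℕ) (hM : 0 < M) (h0 : m ≠ 0) (h1 : |m| < 2 * M) :
    ∑ l ∈ Finset.range M, Real.cos (π * m / M * l) = (1 - Real.cos (m * π)) / 2 := by
  have hMr : (0:ℝ) < M := by exact_mod_cast hM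
  have hs : Real.sin (π * m / M / 2) ≠ 0 := by
    intro h
    obtain ⟨n, hn⟩ := Real.sin_eq_zero_iff.1 h
    have h2 : (n : ℝ) * (2 * M) = m := by
      field_simp at hn
      linarith
    have h3 : n * (2 * M) = m := by exact_mod_cast h2
    have h4 : n ≠ 0 := by rintro rfl; simp at h3; exact h0 h3.symm
    rw [← h3, abs_mul, abs_of_nonneg (by positivity : (0:ℤ) ≤ 2 * M)] at h1
    have : 1 ≤ |n| := Int.one_le_abs h4
    nlinarith
  have := cos_sum_aux (π * m / M) M
  have e : π * m / M * M - π * m / M / 2 = m * π - π * m / M / 2 := by field_simp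
  rw [e, Real.sin_sub, Real.sin_int_mul_pi] at this
  have h3 : (∑ l ∈ Finset.range M, Real.cos (π * m / M * l)) * 2 = 1 - Real.cos (m * π) := by
    apply mul_right_cancel₀ hs
    linarith
  linarith

lemma sineB_mul (j k : ℕ) (x : ℝ) : sineB j x * sineB k x
    = Real.cos (π * ((j : ℤ) - k : ℤ) * x) - Real.cos (π * ((j : ℤ) + k : ℤ) * x) := by
  unfold sineB
  have e1 : π * (((j : ℤ) - k : ℤ) : ℝ) * x = π * j * x - π * k * x := by push_cast; ring
  have e2 : π * (((j : ℤ) + k : ℤ) : ℝ) * x = π * j * x + π * k * x := by push_cast; ring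
  rw [e1, e2, Real.cos_sub, Real.cos_add]
  have := Real.mul_self_sqrt (by norm_num : (0:ℝ) ≤ 2)
  linear_combination Real.sin (π * j * x) * Real.sin (π * k * x) * this

lemma sineB_zero (k : ℕ) : sineB k 0 = 0 := by simp [sineB]

lemma disc_orth (M : ℕ) (hM : 2 ≤ M) (j k : ℕ) (hj : j ∈ Finset.Icc 1 (M - 1))
    (hk : k ∈ Finset.Icc 1 (M - 1)) :
    (1 / (M : ℝ)) * ∑ l ∈ Finset.Icc 1 (M - 1), sineB j ((l : ℝ) / M) * sineB k ((l : ℝ) / M)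
      = if j = k then 1 else 0 := by
  rw [Finset.mem_Icc] at hj hk
  have hM0 : (M : ℝ) ≠ 0 := by positivity
  have e : ∑ l ∈ Finset.Icc 1 (M - 1), sineB j ((l : ℝ) / M) * sineB k ((l : ℝ) / M)
      = ∑ l ∈ Finset.range M, sineB j ((l : ℝ) / M) * sineB k ((l : ℝ) / M) := by
    apply Finset.sum_subset
    · intro l hl; simp at hl ⊢; omega
    · intro l hl hl'
      have : l = 0 := by simp at hl hl'; omega
      subst this; simp [sineB_zero]
  have ec : ∀ (m : ℤ) (l : ℕ), Real.cos (π * m * ((l : ℝ) / M)) = Real.cos (π * m / M * l) := by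
    intro m l; congr 1; ring
  rw [e]
  simp_rw [sineB_mul, ec]
  rw [Finset.sum_sub_distrib, cos_sum ((j : ℤ) + k) M (by omega) (by omega)
    (by rw [abs_of_nonneg (by positivity)]; omega)]
  split_ifs with h
  · subst h
    have : Real.cos ((((j : ℤ) + j : ℤ) : ℝ) * π) = 1 := by
      have := Real.cos_int_mul_two_pi j
      rw [← this]; congr 1; push_cast; ring
    rw [this]; simp [hM0]
  · rw [cos_sum ((j : ℤ) - k) M (by omega) (by omega) (by rw [abs_lt]; omega)]
    have : Real.cos ((((j : ℤ) + k : ℤ) : ℝ) * π) = Real.cos ((((j : ℤ) - k : ℤ) : ℝ) * π) := by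
      have := Real.cos_add_int_mul_two_pi ((((j : ℤ) - k : ℤ) : ℝ) * π) k
      rw [← this]; congr 1; push_cast; ring
    rw [this]; simp

lemma int_cos (m : ℤ) (hm : m ≠ 0) : ∫ x in (0:ℝ)..1, Real.cos (π * m * x) = 0 := by
  have hc : π * (m : ℝ) ≠ 0 := mul_ne_zero Real.pi_ne_zero (by exact_mod_cast hm)
  rw [intervalIntegral.integral_comp_mul_left (fun x => Real.cos x) hc, integral_cos]
  have : Real.sin (π * m * 1) = 0 := by
    rw [mul_one, mul_comm]; exact Real.sin_int_mul_pi m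
  rw [this]; simp

lemma cont_sineB (k : ℕ) : Continuous (sineB k) := by
  unfold sineB; fun_prop

lemma cont_orth (j k : ℕ) (hj : 1 ≤ j) (hk : 1 ≤ k) :
    ∫ x in (0:ℝ)..1, sineB j x * sineB k x = if j = k then 1 else 0 := by
  simp_rw [sineB_mul]
  rw [intervalIntegral.integral_sub
    (Continuous.intervalIntegrable (by fun_prop) _ _)
    (Continuous.intervalIntegrable (by fun_prop) _ _), int_cos ((j : ℤ) + k) (by omega)]
  split_ifs with h
  · subst h; simp
  · rw [int_cos _ (by omega)]; simp

lemma int_sq_sum (a : ℕ → ℝ) (n : ℕ) :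
    ∫ x in (0:ℝ)..1, (∑ k ∈ Finset.Icc 1 n, a k * sineB k x) ^ 2
      = ∑ k ∈ Finset.Icc 1 n, a k ^ 2 := by
  have e : ∀ x, (∑ k ∈ Finset.Icc 1 n, a k * sineB k x) ^ 2
      = ∑ j ∈ Finset.Icc 1 n, ∑ k ∈ Finset.Icc 1 n, a j * a k * (sineB j x * sineB k x) := by
    intro x
    rw [sq, Finset.sum_mul_sum]
    refine Finset.sum_congr rfl fun j _ => Finset.sum_congr rfl fun k _ => by ring
  simp_rw [e]
  have hc : ∀ j k, Continuous fun x => a j * a k * (sineB j x * sineB k x) := fun j k =>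
    continuous_const.mul ((cont_sineB j).mul (cont_sineB k))
  rw [intervalIntegral.integral_finsetSum
    (fun j _ => (continuous_finsetSum _ fun k _ => hc j k).intervalIntegrable _ _)]
  refine Finset.sum_congr rfl fun j hj => ?_
  rw [intervalIntegral.integral_finsetSum (fun k _ => (hc j k).intervalIntegrable _ _)]
  rw [Finset.sum_eq_single j]
  · rw [intervalIntegral.integral_const_mul, cont_orth j j (Finset.mem_Icc.1 hj).1
      (Finset.mem_Icc.1 hj).1]
    simp [sq]
  · intro k hk hkj
    rw [intervalIntegral.integral_const_mul, cont_orth j k (Finset.mem_Icc.1 hj).1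
      (Finset.mem_Icc.1 hk).1]
    simp [hkj.symm]
  · intro h; exact absurd hj h

lemma disc_sq_sum (M : ℕ) (hM : 2 ≤ M) (a : ℕ → ℝ) :
    (1 / (M : ℝ)) * ∑ l ∈ Finset.Icc 1 (M - 1),
      (∑ k ∈ Finset.Icc 1 (M - 1), a k * sineB k ((l : ℝ) / M)) ^ 2
      = ∑ k ∈ Finset.Icc 1 (M - 1), a k ^ 2 := by
  have e : ∀ x, (∑ k ∈ Finset.Icc 1 (M - 1), a k * sineB k x) ^ 2
      = ∑ j ∈ Finset.Icc 1 (M - 1), ∑ k ∈ Finset.Icc 1 (M - 1),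
        a j * a k * (sineB j x * sineB k x) := by
    intro x
    rw [sq, Finset.sum_mul_sum]
    refine Finset.sum_congr rfl fun j _ => Finset.sum_congr rfl fun k _ => by ring
  simp_rw [e]
  rw [Finset.sum_comm, Finset.mul_sum]
  refine Finset.sum_congr rfl fun j hj => ?_
  rw [Finset.sum_comm]
  simp_rw [← Finset.mul_sum]
  rw [Finset.mul_sum, Finset.sum_eq_single j]
  · rw [mul_left_comm, disc_orth M hM j j hj hj]; simp [sq]
  · intro k hk hkj
    rw [mul_left_comm, disc_orth M hM j k hj hk]; simp [hkj.symm]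
  · intro h; exact absurd hj h

lemma disc_bessel (M : ℕ) (hM : 2 ≤ M) (G : ℝ → ℝ) :
    ∑ k ∈ Finset.Icc 1 (M - 1), discIP M G k ^ 2
      ≤ (1 / (M : ℝ)) * ∑ l ∈ Finset.Icc 1 (M - 1), G ((l : ℝ) / M) ^ 2 := by
  have h0 : 0 ≤ (1 / (M : ℝ)) * ∑ l ∈ Finset.Icc 1 (M - 1),
      (G ((l : ℝ) / M) - ∑ k ∈ Finset.Icc 1 (M - 1), discIP M G k * sineB k ((l : ℝ) / M)) ^ 2 := by
    positivity
  have h1 := disc_sq_sum M hM (discIP M G)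
  have h2 : (1 / (M : ℝ)) * ∑ l ∈ Finset.Icc 1 (M - 1),
      G ((l : ℝ) / M) * ∑ k ∈ Finset.Icc 1 (M - 1), discIP M G k * sineB k ((l : ℝ) / M)
      = ∑ k ∈ Finset.Icc 1 (M - 1), discIP M G k ^ 2 := by
    simp_rw [Finset.mul_sum]
    rw [Finset.sum_comm]
    refine Finset.sum_congr rfl fun k _ => ?_
    have hd : discIP M G k = (1 / (M : ℝ)) * ∑ l ∈ Finset.Icc 1 (M - 1),
      G ((l : ℝ) / M) * sineB k ((l : ℝ) / M) := rfl
    rw [sq]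
    generalize discIP M G k = d at hd ⊢
    nth_rewrite 2 [hd]
    rw [Finset.mul_sum, Finset.sum_mul]
    refine Finset.sum_congr rfl fun l _ => ?_
    ring
  simp_rw [sub_sq, Finset.sum_add_distrib, Finset.sum_sub_distrib, mul_add, mul_sub, mul_assoc, ← Finset.mul_sum] at h0
  linarith

lemma trigPoly_self (M N : ℕ) (hM : 2 ≤ M) (hN : N ≤ M - 1) (a : ℕ → ℝ) (x : ℝ) :
    trigPoly M (fun y => ∑ k ∈ Finset.Icc 1 N, a k * sineB k y) x
      = ∑ k ∈ Finset.Icc 1 N, a k * sineB k x := by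
  have hd : ∀ k ∈ Finset.Icc 1 (M - 1),
      discIP M (fun y => ∑ k ∈ Finset.Icc 1 N, a k * sineB k y) k
        = if k ∈ Finset.Icc 1 N then a k else 0 := by
    intro k hk
    unfold discIP
    simp_rw [Finset.sum_mul]
    rw [Finset.sum_comm, Finset.mul_sum]
    have : ∀ j ∈ Finset.Icc 1 N, (1 / (M : ℝ)) * ∑ l ∈ Finset.Icc 1 (M - 1),
        a j * sineB j ((l : ℝ) / M) * sineB k ((l : ℝ) / M) = if j = k then a j else 0 := by
      intro j hj
      simp_rw [mul_assoc]
      rw [← Finset.mul_sum, mul_left_comm, disc_orth M hM j k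
        (by rw [Finset.mem_Icc] at hj ⊢; omega) hk]
      simp
    rw [Finset.sum_congr rfl this]
    simp
  unfold trigPoly
  rw [Finset.sum_congr rfl fun k hk => by rw [hd k hk]]
  symm
  have hsub : Finset.Icc 1 N ⊆ Finset.Icc 1 (M - 1) := Finset.Icc_subset_Icc le_rfl hN
  rw [← Finset.sum_subset hsub]
  · exact Finset.sum_congr rfl fun k hk => by rw [if_pos hk]
  · intro k _ hk; rw [if_neg hk]; simp

lemma trigPoly_sub (M : ℕ) (f g : ℝ → ℝ) (x : ℝ) :
    trigPoly M (fun y => f y - g y) x = trigPoly M f x - trigPoly M g x := by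
  unfold trigPoly discIP
  simp only [sub_mul, Finset.sum_sub_distrib, mul_sub]

lemma int_tail (H : ℝ → ℝ) (hH : ContinuousOn H (Set.Icc 0 1)) (N : ℕ) :
    ∫ x in (0:ℝ)..1, (H x - ∑ k ∈ Finset.Icc 1 N, fourierSineCoef H k * sineB k x) ^ 2
      = (∫ x in (0:ℝ)..1, H x ^ 2) - ∑ k ∈ Finset.Icc 1 N, fourierSineCoef H k ^ 2 := by
  have hH' : ContinuousOn H (Set.uIcc 0 1) := by rwa [Set.uIcc_of_le (by norm_num)]
  set P : ℝ → ℝ := fun x => ∑ k ∈ Finset.Icc 1 N, fourierSineCoef H k * sineB k x with hP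
  have hPc : Continuous P := continuous_finsetSum _ fun k _ =>
    continuous_const.mul (cont_sineB k)
  have h1 : ∫ x in (0:ℝ)..1, P x ^ 2 = ∑ k ∈ Finset.Icc 1 N, fourierSineCoef H k ^ 2 :=
    int_sq_sum _ N
  have h2 : ∫ x in (0:ℝ)..1, H x * P x = ∑ k ∈ Finset.Icc 1 N, fourierSineCoef H k ^ 2 := by
    have : ∀ x, H x * P x = ∑ k ∈ Finset.Icc 1 N, fourierSineCoef H k * (H x * sineB k x) := by
      intro x; rw [hP, Finset.mul_sum]
      exact Finset.sum_congr rfl fun k _ => by ring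
    simp_rw [this]
    rw [intervalIntegral.integral_finsetSum]
    · refine Finset.sum_congr rfl fun k _ => ?_
      rw [intervalIntegral.integral_const_mul, sq]; rfl
    · intro k _
      exact (continuousOn_const.mul (hH'.mul (cont_sineB k).continuousOn)).intervalIntegrable
  have e : ∀ x, (H x - P x) ^ 2 = H x ^ 2 - 2 * (H x * P x) + P x ^ 2 := fun x => by ring
  have i1 : IntervalIntegrable (fun x => H x ^ 2) MeasureTheory.volume 0 1 :=
    (hH'.pow 2).intervalIntegrable
  have i2 : IntervalIntegrable (fun x => 2 * (H x * P x)) MeasureTheory.volume 0 1 :=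
    (continuousOn_const.mul (hH'.mul hPc.continuousOn)).intervalIntegrable
  have i3 : IntervalIntegrable (fun x => P x ^ 2) MeasureTheory.volume 0 1 :=
    (hPc.pow 2).intervalIntegrable _ _
  change ∫ x in (0:ℝ)..1, (H x - P x) ^ 2 = _
  simp_rw [e]
  rw [intervalIntegral.integral_add (i1.sub i2) i3, intervalIntegral.integral_sub i1 i2,
    intervalIntegral.integral_const_mul, h1, h2]
  ring

lemma tail_bound (H : ℝ → ℝ) (hH : ContinuousOn H (Set.Icc 0 1)) (N : ℕ) (w : ℕ → ℝ) (W B : ℝ)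
    (hw0 : ∀ l, 0 ≤ w l) (hw : ∀ l, N ≤ l → W ≤ w l)
    (hs : Summable fun l : ℕ => w l * fourierSineCoef H (l + 1) ^ 2)
    (hB : ∑' l : ℕ, w l * fourierSineCoef H (l + 1) ^ 2 ≤ B) :
    W * ∫ x in (0:ℝ)..1, (H x - ∑ k ∈ Finset.Icc 1 N, fourierSineCoef H k * sineB k x) ^ 2 ≤ B := by
  rw [int_tail H hH N]
  have hp := parseval H hH
  rw [← hasSum_nat_add_iff' N] at hp
  have e : ∑ k ∈ Finset.Icc 1 N, fourierSineCoef H k ^ 2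
      = ∑ i ∈ Finset.range N, fourierSineCoef H (i + 1) ^ 2 := by
    rw [Finset.range_eq_Ico, Finset.sum_Ico_add' (fun k => fourierSineCoef H k ^ 2) 0 N 1]
    rfl
  rw [e]
  have h1 := hp.mul_left W
  have h2 : Summable fun l : ℕ => w (l + N) * fourierSineCoef H (l + N + 1) ^ 2 :=
    (summable_nat_add_iff (f := fun l : ℕ => w l * fourierSineCoef H (l + 1) ^ 2) N).2 hs
  have h3 := hasSum_le (fun l => mul_le_mul_of_nonneg_right (hw (l + N) (by omega))
    (sq_nonneg (fourierSineCoef H (l + N + 1)))) h1 h2.hasSum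
  have h4 := hs.sum_add_tsum_nat_add N
  have h5 : 0 ≤ ∑ i ∈ Finset.range N, w i * fourierSineCoef H (i + 1) ^ 2 :=
    Finset.sum_nonneg fun i _ => mul_nonneg (hw0 i) (sq_nonneg _)
  linarith

lemma riemann_bound (M : ℕ) (hM : 2 ≤ M) (G : ℝ → ℝ) (hG : ContinuousOn G (Set.Icc 0 1)) (ω : ℝ)
    (hω : ∀ x ∈ Set.Icc (0:ℝ) 1, ∀ y ∈ Set.Icc (0:ℝ) 1, |x - y| ≤ 1 / M → |G x - G y| ≤ ω) :
    (1 / (M : ℝ)) * ∑ l ∈ Finset.Icc 1 (M - 1), G ((l : ℝ) / M) ^ 2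
      ≤ 2 * (∫ x in (0:ℝ)..1, G x ^ 2) + 2 * ω ^ 2 := by
  have hM0 : (0:ℝ) < M := by positivity
  have hG' : ContinuousOn (fun x => 2 * G x ^ 2 + 2 * ω ^ 2) (Set.Icc 0 1) := by fun_prop
  have hmem : ∀ l : ℕ, l < M → Set.Icc ((l:ℝ) / M) (((l + 1 : ℕ):ℝ) / M) ⊆ Set.Icc 0 1 := by
    intro l hl
    refine Set.Icc_subset_Icc (by positivity) ?_
    rw [div_le_one hM0]; exact_mod_cast hl
  have hle : ∀ l : ℕ, (l:ℝ) / M ≤ ((l + 1 : ℕ):ℝ) / M := fun l => by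
    gcongr; omega
  have hint : ∀ l < M, IntervalIntegrable (fun x => 2 * G x ^ 2 + 2 * ω ^ 2) MeasureTheory.volume
      ((l:ℝ) / M) (((l + 1 : ℕ):ℝ) / M) := by
    intro l hl
    apply ContinuousOn.intervalIntegrable
    rw [Set.uIcc_of_le (hle l)]
    exact hG'.mono (hmem l hl)
  have hsum := intervalIntegral.sum_integral_adjacent_intervals
    (a := fun l : ℕ => (l:ℝ) / M) hint
  have hI : ∫ x in (0:ℝ)..1, (2 * G x ^ 2 + 2 * ω ^ 2)
      = 2 * (∫ x in (0:ℝ)..1, G x ^ 2) + 2 * ω ^ 2 := by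
    have hG2 : ContinuousOn (fun x => 2 * G x ^ 2) (Set.uIcc 0 1) := by
      rw [Set.uIcc_of_le (by norm_num)]; fun_prop
    rw [intervalIntegral.integral_add hG2.intervalIntegrable
      (continuous_const.intervalIntegrable _ _), intervalIntegral.integral_const_mul]
    simp
  have h01 : ((M:ℕ):ℝ) / M = 1 := div_self hM0.ne'
  simp only [h01, Nat.cast_zero, zero_div, hI] at hsum
  rw [← hsum, Finset.mul_sum]
  have hterm : ∀ l ∈ Finset.range M, (1 / (M:ℝ)) * G ((l:ℝ) / M) ^ 2
      ≤ ∫ x in ((l:ℝ) / M)..(((l + 1 : ℕ):ℝ) / M), (2 * G x ^ 2 + 2 * ω ^ 2) := by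
    intro l hl
    have hl := Finset.mem_range.1 hl
    have hc : (1 / (M:ℝ)) * G ((l:ℝ) / M) ^ 2
        = ∫ x in ((l:ℝ) / M)..(((l + 1 : ℕ):ℝ) / M), G ((l:ℝ) / M) ^ 2 := by
      rw [intervalIntegral.integral_const, smul_eq_mul]; push_cast; ring
    rw [hc]
    refine intervalIntegral.integral_mono_on (hle l) (continuous_const.intervalIntegrable _ _)
      (hint l hl) fun x hx => ?_
    have h1 := hω _ (hmem l hl ⟨le_rfl, hle l⟩) x (hmem l hl hx) (by
      rw [abs_le]
      have := hx.1; have h2 := hx.2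
      push_cast at h2
      rw [add_div] at h2
      have : 0 < 1 / (M:ℝ) := by positivity
      constructor <;> linarith)
    have h2 : (G ((l:ℝ) / M) - G x) ^ 2 ≤ ω ^ 2 := sq_le_sq' (abs_le.1 h1).1 (abs_le.1 h1).2
    nlinarith [sq_nonneg (G ((l:ℝ) / M) - 2 * G x)]
  refine le_trans ?_ (Finset.sum_le_sum hterm)
  refine Finset.sum_le_sum_of_subset_of_nonneg ?_ ?_
  · intro l hl; simp at hl ⊢; omega
  · intros; positivity

lemma abs_sineB_le (k : ℕ) (x : ℝ) : |sineB k x| ≤ √2 := by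
  unfold sineB
  rw [abs_mul, abs_of_nonneg (Real.sqrt_nonneg _)]
  exact mul_le_of_le_one_right (Real.sqrt_nonneg _) (Real.abs_sin_le_one _)

lemma coef_le (H : ℝ → ℝ) (K : ℝ) (hb : ∀ x ∈ Set.Icc (0 : ℝ) 1, |H x| ≤ K) (k : ℕ) :
    |fourierSineCoef H k| ≤ √2 * K := by
  have := intervalIntegral.norm_integral_le_of_norm_le_const (a := (0:ℝ)) (b := 1)
    (f := fun y => H y * sineB k y) (C := √2 * K) (by
      intro x hx
      rw [Set.uIoc_of_le (by norm_num)] at hx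
      rw [norm_mul, Real.norm_eq_abs, Real.norm_eq_abs, mul_comm]
      exact mul_le_mul (abs_sineB_le k x) (hb x ⟨hx.1.le, hx.2⟩) (abs_nonneg _)
        (Real.sqrt_nonneg _))
  simpa [fourierSineCoef] using this

lemma sineB_lip (k : ℕ) (x y : ℝ) : |sineB k x - sineB k y| ≤ √2 * (π * k * |x - y|) := by
  unfold sineB
  rw [← mul_sub, abs_mul, abs_of_nonneg (Real.sqrt_nonneg _)]
  refine mul_le_mul_of_nonneg_left ?_ (Real.sqrt_nonneg _)
  have h := Real.lipschitzWith_sin.dist_le_mul (π * k * x) (π * k * y)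
  rw [Real.dist_eq, Real.dist_eq, ← mul_sub, abs_mul,
    abs_of_nonneg (by positivity : 0 ≤ π * (k:ℝ)), NNReal.coe_one, one_mul] at h
  exact h

lemma P_osc (H : ℝ → ℝ) (K : ℝ) (hK : 0 ≤ K) (hb : ∀ x ∈ Set.Icc (0 : ℝ) 1, |H x| ≤ K) (N : ℕ)
    (x y : ℝ) :
    |(∑ k ∈ Finset.Icc 1 N, fourierSineCoef H k * sineB k x)
      - ∑ k ∈ Finset.Icc 1 N, fourierSineCoef H k * sineB k y| ≤ 2 * π * K * N ^ 2 * |x - y| := by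
  rw [← Finset.sum_sub_distrib]
  have h : ∀ k ∈ Finset.Icc 1 N, |fourierSineCoef H k * sineB k x - fourierSineCoef H k * sineB k y|
      ≤ 2 * π * K * N * |x - y| := by
    intro k hk
    have hkN : (k:ℝ) ≤ N := by exact_mod_cast (Finset.mem_Icc.1 hk).2
    rw [← mul_sub, abs_mul]
    have h2 := Real.mul_self_sqrt (by norm_num : (0:ℝ) ≤ 2)
    calc _ ≤ (√2 * K) * (√2 * (π * k * |x - y|)) :=
          mul_le_mul (coef_le H K hb k) (sineB_lip k x y) (abs_nonneg _) (by positivity)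
      _ = 2 * π * K * k * |x - y| := by linear_combination K * π * k * |x - y| * h2
      _ ≤ _ := by gcongr
  refine (Finset.abs_sum_le_sum_abs _ _).trans ((Finset.sum_le_sum h).trans ?_)
  simp
  apply le_of_eq; ring

/-- For `α ∈ (0,1/2)` and `ϑ > 0` there is a constant `C = C(α,ϑ)` such that for every `M ≥ 2`
and every continuous `H : [0,1] → ℝ` with `‖H‖_∞ ≤ K`, `2α`-Hölder constant `≤ K` and
`∑_ℓ (ϑπ²ℓ²)^{2α} h_ℓ² ≤ K²`, one has `∫₀¹ (H − H^M)² ≤ C K² M^{−8α²/(4α+1)}`. -/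
theorem L2_approximation_of_trig_interpolation (α ϑ : ℝ)
    (hα : α ∈ Set.Ioo (0 : ℝ) (1 / 2)) (hϑ : 0 < ϑ) :
    ∃ C > (0 : ℝ), ∀ (M : ℕ), 2 ≤ M → ∀ (H : ℝ → ℝ) (K : ℝ), 0 ≤ K →
      ContinuousOn H (Set.Icc 0 1) →
      (∀ x ∈ Set.Icc (0 : ℝ) 1, |H x| ≤ K) →
      (∀ x ∈ Set.Icc (0 : ℝ) 1, ∀ y ∈ Set.Icc (0 : ℝ) 1,
        |H x - H y| ≤ K * |x - y| ^ (2 * α)) →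
      Summable (fun ℓ : ℕ =>
        (ϑ * π ^ 2 * ((ℓ : ℝ) + 1) ^ 2) ^ (2 * α) * (fourierSineCoef H (ℓ + 1)) ^ 2) →
      (∑' ℓ : ℕ,
        (ϑ * π ^ 2 * ((ℓ : ℝ) + 1) ^ 2) ^ (2 * α) * (fourierSineCoef H (ℓ + 1)) ^ 2) ≤ K ^ 2 →
      (∫ x in (0 : ℝ)..1, (H x - trigPoly M H x) ^ 2)
        ≤ C * K ^ 2 * (M : ℝ) ^ (-(8 * α ^ 2) / (4 * α + 1)) := by
  obtain ⟨hα0, hα1⟩ := hα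
  set A : ℝ := (ϑ * π ^ 2) ^ (2 * α) with hA
  have hApos : 0 < A := by positivity
  refine ⟨6 / A + 4 * (1 + 2 * π) ^ 2, by positivity, ?_⟩
  intro M hM H K hK hH hb hol hs hsum
  set β : ℝ := 2 * α / (4 * α + 1) with hβ
  have hβ0 : 0 < β := by positivity
  have hβ1 : β < 1 := by rw [hβ, div_lt_one (by positivity)]; linarith
  have hβ2 : 2 * β * (1 + α) ≤ 1 := by
    have : 2 * β * (1 + α) = (4 * α * (1 + α)) / (4 * α + 1) := by rw [hβ]; field_simp; ring
    rw [this, div_le_one (by positivity)]; nlinarith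
  have hexp : -(8 * α ^ 2) / (4 * α + 1) = -(4 * α * β) := by rw [hβ]; field_simp; ring
  rw [hexp]
  have hM1 : (1:ℝ) < M := by exact_mod_cast (by omega : 1 < M)
  have hM0 : (0:ℝ) < M := by linarith
  set N : ℕ := ⌊(M:ℝ) ^ β⌋₊ with hN
  have hNle : (N:ℝ) ≤ (M:ℝ) ^ β := Nat.floor_le (by positivity)
  have hNlt : (M:ℝ) ^ β < N + 1 := Nat.lt_floor_add_one _
  have hNM : N ≤ M - 1 := by
    have h1 : (M:ℝ) ^ β < M := by
      conv_rhs => rw [← Real.rpow_one (M:ℝ)]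
      exact Real.rpow_lt_rpow_of_exponent_lt hM1 hβ1
    have : (N:ℝ) < M := lt_of_le_of_lt hNle h1
    have : N < M := by exact_mod_cast this
    omega
  set P : ℝ → ℝ := fun x => ∑ k ∈ Finset.Icc 1 N, fourierSineCoef H k * sineB k x with hP
  have hPc : Continuous P := continuous_finsetSum _ fun k _ =>
    continuous_const.mul (cont_sineB k)
  set G : ℝ → ℝ := fun x => H x - P x with hG
  have hGc : ContinuousOn G (Set.Icc 0 1) := hH.sub hPc.continuousOn
  set Q : ℝ := (M:ℝ) ^ (-(4 * α * β)) with hQ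
  have hQpos : 0 < Q := by positivity
  -- tail
  have hT : ∫ x in (0:ℝ)..1, G x ^ 2 ≤ K ^ 2 / A * Q := by
    have h := tail_bound H hH N (fun ℓ => (ϑ * π ^ 2 * ((ℓ : ℝ) + 1) ^ 2) ^ (2 * α)) (A / Q) (K ^ 2)
      (fun l => by positivity) (fun l hl => by
        have h1 : (M:ℝ) ^ β ≤ (l:ℝ) + 1 := by
          have : (N:ℝ) ≤ l := by exact_mod_cast hl
          linarith
        have h2 : A / Q = (ϑ * π ^ 2 * ((M:ℝ) ^ β) ^ 2) ^ (2 * α) := by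
          rw [Real.mul_rpow (by positivity) (by positivity), ← hA, div_eq_mul_inv, hQ,
            ← Real.rpow_neg hM0.le, ← Real.rpow_natCast, ← Real.rpow_mul hM0.le,
            ← Real.rpow_mul hM0.le]
          congr 2; push_cast; ring
        rw [h2]
        gcongr) hs hsum
    change A / Q * ∫ x in (0:ℝ)..1, G x ^ 2 ≤ K ^ 2 at h
    rw [div_mul_eq_mul_div, div_le_iff₀ hQpos] at h
    rw [div_mul_eq_mul_div, le_div_iff₀ hApos]
    linarith
  -- oscillation
  set q : ℝ := (M:ℝ) ^ (-(2 * α * β)) with hq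
  have hqq : q ^ 2 = Q := by
    rw [hq, hQ, ← Real.rpow_natCast, ← Real.rpow_mul hM0.le]; congr 1; push_cast; ring
  have hq1 : (1 / (M:ℝ)) ^ (2 * α) ≤ q := by
    rw [one_div, Real.inv_rpow hM0.le, ← Real.rpow_neg hM0.le, hq]
    apply Real.rpow_le_rpow_of_exponent_le hM1.le
    nlinarith
  have hq2 : (N:ℝ) ^ 2 * (1 / M) ≤ q := by
    calc (N:ℝ) ^ 2 * (1 / M) ≤ ((M:ℝ) ^ β) ^ 2 * (1 / M) := by gcongr
      _ = (M:ℝ) ^ (2 * β - 1) := by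
        rw [Real.rpow_sub hM0, Real.rpow_one, ← Real.rpow_natCast, ← Real.rpow_mul hM0.le]
        push_cast; ring_nf
      _ ≤ q := by
        rw [hq]
        apply Real.rpow_le_rpow_of_exponent_le hM1.le
        nlinarith
  have hosc : ∀ x ∈ Set.Icc (0:ℝ) 1, ∀ y ∈ Set.Icc (0:ℝ) 1, |x - y| ≤ 1 / M →
      |G x - G y| ≤ K * (1 + 2 * π) * q := by
    intro x hx y hy hxy
    have h1 := hol x hx y hy
    have h2 := P_osc H K hK hb N x y
    have h3 : |G x - G y| ≤ |H x - H y| + |P x - P y| := by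
      have : G x - G y = (H x - H y) - (P x - P y) := by simp only [hG]; ring
      rw [this]; exact abs_sub _ _
    have h4 : K * |x - y| ^ (2 * α) ≤ K * q := by
      refine mul_le_mul_of_nonneg_left (le_trans ?_ hq1) hK
      exact Real.rpow_le_rpow (abs_nonneg _) hxy (by positivity)
    have h5 : 2 * π * K * N ^ 2 * |x - y| ≤ 2 * π * K * q := by
      calc _ ≤ 2 * π * K * N ^ 2 * (1 / M) := by gcongr
        _ = 2 * π * K * (N ^ 2 * (1 / M)) := by ring
        _ ≤ _ := by gcongr
    have h2' : |P x - P y| ≤ 2 * π * K * N ^ 2 * |x - y| := h2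
    linarith
  have hR := riemann_bound M hM G hGc _ hosc
  have hBs := disc_bessel M hM G
  have hTG : ∫ x in (0:ℝ)..1, trigPoly M G x ^ 2 = ∑ k ∈ Finset.Icc 1 (M - 1), discIP M G k ^ 2 :=
    int_sq_sum _ _
  have hdiff : ∀ x, H x - trigPoly M H x = G x - trigPoly M G x := by
    intro x
    have h1 : trigPoly M G x = trigPoly M H x - trigPoly M P x := trigPoly_sub M H P x
    have h2 : trigPoly M P x = P x := trigPoly_self M N hM hNM _ x
    rw [h1, h2]; simp only [hG]; ring
  have htc : Continuous (trigPoly M G) := continuous_finsetSum _ fun k _ =>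
    continuous_const.mul (cont_sineB k)
  have hGu : ContinuousOn G (Set.uIcc 0 1) := by rwa [Set.uIcc_of_le (by norm_num)]
  have i1 : IntervalIntegrable (fun x => 2 * G x ^ 2) MeasureTheory.volume 0 1 :=
    (continuousOn_const.mul (hGu.pow 2)).intervalIntegrable
  have i2 : IntervalIntegrable (fun x => 2 * trigPoly M G x ^ 2) MeasureTheory.volume 0 1 :=
    (continuous_const.mul (htc.pow 2)).intervalIntegrable _ _
  have hfin : ∫ x in (0:ℝ)..1, (H x - trigPoly M H x) ^ 2
      ≤ 2 * (∫ x in (0:ℝ)..1, G x ^ 2) + 2 * ∫ x in (0:ℝ)..1, trigPoly M G x ^ 2 := by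
    rw [← intervalIntegral.integral_const_mul, ← intervalIntegral.integral_const_mul,
      ← intervalIntegral.integral_add i1 i2]
    refine intervalIntegral.integral_mono_on (by norm_num) ?_ (i1.add i2) fun x _ => ?_
    · simp_rw [hdiff]
      exact ((hGu.sub htc.continuousOn).pow 2).intervalIntegrable
    · rw [hdiff]; nlinarith [sq_nonneg (G x + trigPoly M G x)]
  have e1 : (K * (1 + 2 * π) * q) ^ 2 = K ^ 2 * (1 + 2 * π) ^ 2 * Q := by rw [← hqq]; ring
  have e2 : (6 / A + 4 * (1 + 2 * π) ^ 2) * K ^ 2 * Q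
      = 6 * (K ^ 2 / A * Q) + 4 * (K ^ 2 * (1 + 2 * π) ^ 2 * Q) := by ring
  rw [e1] at hR
  rw [e2]
  linarith
end

section
/- For every ϑ > 0 there exist constants c, C > 0 such that for all δ ∈ (0,1] and Δ ∈ (0,1]: c·min(δ, √Δ) ≤ Φ_ϑ(δ, Δ) ≤ C·min(δ, √Δ), where Φ_ϑ(δ, Δ) := 2·∑_{ℓ=1}^{∞} (1 − e^{−π²ϑℓ²Δ})·(1 − cos(πℓδ)) / (π²ϑℓ²). -/
open Real

/-- The renormalization of the realized quadratic variation of double increments: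
`Φ_ϑ(δ,Δ) = 2 ∑_{ℓ≥1} (1 − e^{−π²ϑℓ²Δ})(1 − cos(πℓδ))/(π²ϑℓ²)`. -/
noncomputable def Phi (ϑ δ Δ : ℝ) : ℝ :=
  2 * ∑' ℓ : ℕ, (1 - Real.exp (-(Real.pi ^ 2 * ϑ * ((ℓ : ℝ) + 1) ^ 2 * Δ)))
      * (1 - Real.cos (Real.pi * ((ℓ : ℝ) + 1) * δ)) / (Real.pi ^ 2 * ϑ * ((ℓ : ℝ) + 1) ^ 2)

noncomputable def PhiT (ϑ δ Δ : ℝ) (ℓ : ℕ) : ℝ :=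
  (1 - Real.exp (-(Real.pi ^ 2 * ϑ * ((ℓ : ℝ) + 1) ^ 2 * Δ)))
      * (1 - Real.cos (Real.pi * ((ℓ : ℝ) + 1) * δ)) / (Real.pi ^ 2 * ϑ * ((ℓ : ℝ) + 1) ^ 2)

lemma PhiT_nonneg (ϑ δ Δ : ℝ) (hϑ : 0 < ϑ) (hΔ : 0 < Δ) (ℓ : ℕ) : 0 ≤ PhiT ϑ δ Δ ℓ := by
  unfold PhiT
  have h1 : 0 ≤ 1 - Real.exp (-(Real.pi ^ 2 * ϑ * ((ℓ : ℝ) + 1) ^ 2 * Δ)) := by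
    have : Real.exp (-(Real.pi ^ 2 * ϑ * ((ℓ : ℝ) + 1) ^ 2 * Δ)) ≤ 1 := by
      rw [Real.exp_le_one_iff]
      have : 0 ≤ Real.pi ^ 2 * ϑ * ((ℓ : ℝ) + 1) ^ 2 * Δ := by positivity
      linarith
    linarith
  have h2 : 0 ≤ 1 - Real.cos (Real.pi * ((ℓ : ℝ) + 1) * δ) := by
    linarith [Real.cos_le_one (Real.pi * ((ℓ : ℝ) + 1) * δ)]
  positivity

lemma tele_bound (x K : ℝ) (hx : 0 < x) (hK : 0 ≤ K) (f : ℕ → ℝ)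
    (h1 : ∀ ℓ, f ℓ ≤ K * x ^ 2) (h2 : ∀ ℓ : ℕ, f ℓ ≤ K / ((ℓ : ℝ) + 1) ^ 2) (N : ℕ) :
    ∑ ℓ ∈ Finset.range N, f ℓ ≤ 4 * K * x := by
  have key : ∀ ℓ : ℕ, f ℓ ≤ 4 * K * x * (1 / (1 + (ℓ : ℝ) * x) - 1 / (1 + ((ℓ + 1 : ℕ) : ℝ) * x)) := by
    intro ℓ
    have hl : (0 : ℝ) ≤ ℓ := Nat.cast_nonneg ℓ
    have e : 4 * K * x * (1 / (1 + (ℓ : ℝ) * x) - 1 / (1 + ((ℓ + 1 : ℕ) : ℝ) * x))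
        = K * (4 * x ^ 2 / ((1 + (ℓ : ℝ) * x) * (1 + ((ℓ : ℝ) + 1) * x))) := by
      push_cast
      have : 1 + (ℓ : ℝ) * x ≠ 0 := by positivity
      have : 1 + ((ℓ : ℝ) + 1) * x ≠ 0 := by positivity
      field_simp
      ring
    rw [e]
    have hlx : 0 ≤ (ℓ : ℝ) * x := by positivity
    rcases le_total (((ℓ : ℝ) + 1) * x) 1 with h | h
    · refine (h1 ℓ).trans (mul_le_mul_of_nonneg_left ?_ hK)
      rw [le_div_iff₀ (by positivity)]
      have : (1 + (ℓ : ℝ) * x) * (1 + ((ℓ : ℝ) + 1) * x) ≤ 2 * 2 := by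
        apply mul_le_mul <;> nlinarith
      nlinarith [sq_nonneg x]
    · refine (h2 ℓ).trans ?_
      rw [div_eq_mul_one_div]
      refine mul_le_mul_of_nonneg_left ?_ hK
      rw [div_le_div_iff₀ (by positivity) (by positivity)]
      have : (1 + (ℓ : ℝ) * x) * (1 + ((ℓ : ℝ) + 1) * x)
          ≤ (2 * (((ℓ : ℝ) + 1) * x)) * (2 * (((ℓ : ℝ) + 1) * x)) := by
        apply mul_le_mul <;> nlinarith
      nlinarith
  calc ∑ ℓ ∈ Finset.range N, f ℓ
      ≤ ∑ ℓ ∈ Finset.range N, 4 * K * x * (1 / (1 + (ℓ : ℝ) * x) - 1 / (1 + ((ℓ + 1 : ℕ) : ℝ) * x)) :=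
        Finset.sum_le_sum fun i _ => key i
    _ = 4 * K * x * (1 - 1 / (1 + (N : ℝ) * x)) := by
        rw [← Finset.mul_sum, Finset.sum_range_sub' (fun n : ℕ => 1 / (1 + (n : ℝ) * x))]
        simp
    _ ≤ 4 * K * x := by
        have : 0 ≤ 1 / (1 + (N : ℝ) * x) := by positivity
        have : 0 ≤ 4 * K * x := by positivity
        nlinarith

lemma PhiT_le (ϑ δ Δ : ℝ) (hϑ : 0 < ϑ) (hΔ : 0 < Δ) (ℓ : ℕ) :
    PhiT ϑ δ Δ ℓ ≤ (2 + 1 / ϑ) / ((ℓ : ℝ) + 1) ^ 2 ∧ PhiT ϑ δ Δ ℓ ≤ (2 + 1 / ϑ) * δ ^ 2 ∧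
      PhiT ϑ δ Δ ℓ ≤ (2 + 1 / ϑ) * (√Δ) ^ 2 := by
  rw [Real.sq_sqrt hΔ.le]
  unfold PhiT
  set n : ℝ := (ℓ : ℝ) + 1 with hn
  have hn0 : 0 < n := by positivity
  have hpi := Real.pi_gt_three
  have hA0 : 0 < π ^ 2 * ϑ * n ^ 2 := by positivity
  have hE0 : 0 ≤ 1 - Real.exp (-(π ^ 2 * ϑ * n ^ 2 * Δ)) := by
    have : Real.exp (-(π ^ 2 * ϑ * n ^ 2 * Δ)) ≤ 1 := by
      rw [Real.exp_le_one_iff]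
      have : 0 ≤ π ^ 2 * ϑ * n ^ 2 * Δ := by positivity
      linarith
    linarith
  have hE1 : 1 - Real.exp (-(π ^ 2 * ϑ * n ^ 2 * Δ)) ≤ 1 := by
    linarith [Real.exp_pos (-(π ^ 2 * ϑ * n ^ 2 * Δ))]
  have hE2 : 1 - Real.exp (-(π ^ 2 * ϑ * n ^ 2 * Δ)) ≤ π ^ 2 * ϑ * n ^ 2 * Δ := by
    linarith [Real.add_one_le_exp (-(π ^ 2 * ϑ * n ^ 2 * Δ))]
  have hC0 : 0 ≤ 1 - Real.cos (π * n * δ) := by linarith [Real.cos_le_one (π * n * δ)]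
  have hC1 : 1 - Real.cos (π * n * δ) ≤ 2 := by linarith [Real.neg_one_le_cos (π * n * δ)]
  have hC2 : 1 - Real.cos (π * n * δ) ≤ (π * n * δ) ^ 2 / 2 := by
    linarith [Real.one_sub_sq_div_two_le_cos (x := π * n * δ)]
  have hi : 0 < 1 / ϑ := by positivity
  refine ⟨?_, ?_, ?_⟩
  · calc _ ≤ 1 * 2 / (π ^ 2 * ϑ * n ^ 2) := by gcongr
      _ = (2 / π ^ 2) * (1 / ϑ) / n ^ 2 := by field_simp
      _ ≤ _ := by
        gcongr
        have : 2 / π ^ 2 ≤ 1 := by rw [div_le_one (by positivity)]; nlinarith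
        nlinarith
  · calc _ ≤ 1 * ((π * n * δ) ^ 2 / 2) / (π ^ 2 * ϑ * n ^ 2) := by gcongr
      _ = (1 / ϑ / 2) * δ ^ 2 := by field_simp
      _ ≤ _ := by gcongr; linarith
  · calc _ ≤ (π ^ 2 * ϑ * n ^ 2 * Δ) * 2 / (π ^ 2 * ϑ * n ^ 2) := by gcongr
      _ = 2 * Δ := by field_simp
      _ ≤ _ := by gcongr; linarith

lemma cos_pair (a b : ℝ) (hb : π / 2 ≤ b) (hb' : b ≤ π) :
    1 / 2 ≤ (1 - Real.cos a) + (1 - Real.cos (a + b)) := by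
  -- cos a + cos (a+b) = 2 cos(a + b/2) cos(b/2)
  have e : Real.cos a + Real.cos (a + b) = 2 * Real.cos (a + b / 2) * Real.cos (b / 2) := by
    have h1 := Real.cos_sub (a + b / 2) (b / 2)
    have h2 := Real.cos_add (a + b / 2) (b / 2)
    rw [show a + b / 2 - b / 2 = a by ring] at h1
    rw [show a + b / 2 + b / 2 = a + b by ring] at h2
    rw [h1, h2]; ring
  have h0 : 0 ≤ Real.cos (b / 2) := Real.cos_nonneg_of_mem_Icc ⟨by linarith [Real.pi_pos], by linarith⟩
  have hsq : Real.cos (b / 2) ^ 2 ≤ 1 / 2 := by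
    rw [Real.cos_sq]
    have : Real.cos (2 * (b / 2)) ≤ 0 :=
      Real.cos_nonpos_of_pi_div_two_le_of_le (by linarith) (by linarith [Real.pi_pos])
    linarith
  have h34 : Real.cos (b / 2) ≤ 3 / 4 := by nlinarith
  have : 2 * Real.cos (a + b / 2) * Real.cos (b / 2) ≤ 3 / 2 := by
    nlinarith [Real.cos_le_one (a + b / 2)]
  linarith

lemma exists_shift (δ : ℝ) (h0 : 0 < δ) (h1 : δ ≤ 1) :
    ∃ k : ℕ, 1 / 2 ≤ k * δ ∧ k * δ ≤ 1 := by
  have hk1 : (1 : ℝ) ≤ ⌊1 / δ⌋₊ := by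
    have : 1 ≤ ⌊1 / δ⌋₊ := by
      rw [Nat.one_le_floor_iff, le_div_iff₀ h0]; linarith
    exact_mod_cast this
  refine ⟨⌊1 / δ⌋₊, ?_, ?_⟩
  · have := Nat.lt_floor_add_one (1 / δ)
    rw [div_lt_iff₀ h0] at this
    nlinarith
  · have := Nat.floor_le (a := 1 / δ) (by positivity)
    rwa [le_div_iff₀ h0] at this

lemma block_le (f : ℕ → ℝ) (hf : Summable f) (h0 : ∀ i, 0 ≤ f i) (M N : ℕ) :
    ∑ j ∈ Finset.range N, f (M + j) ≤ ∑' i, f i := by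
  have h := Finset.sum_Ico_eq_sum_range f M (M + N)
  rw [Nat.add_sub_cancel_left] at h
  rw [← h]
  exact hf.sum_le_tsum _ fun i _ => h0 i

lemma PhiT_ge (ϑ δ Δ : ℝ) (hϑ : 0 < ϑ) (N ℓ : ℕ) (hN : 0 < N) (h1 : N ≤ ℓ) (h2 : ℓ + 1 ≤ 3 * N)
    (hs : 1 ≤ (N : ℝ) ^ 2 * Δ) (hΔ : 0 < Δ) :
    (1 - Real.exp (-(π ^ 2 * ϑ))) / (9 * π ^ 2 * ϑ * (N : ℝ) ^ 2)
      * (1 - Real.cos (π * ((ℓ : ℝ) + 1) * δ)) ≤ PhiT ϑ δ Δ ℓ := by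
  unfold PhiT
  have hN' : (0 : ℝ) < N := by exact_mod_cast hN
  have h1' : (N : ℝ) ≤ ℓ := by exact_mod_cast h1
  have h2' : (ℓ : ℝ) + 1 ≤ 3 * N := by exact_mod_cast h2
  have hC0 : 0 ≤ 1 - Real.cos (π * ((ℓ : ℝ) + 1) * δ) := by
    linarith [Real.cos_le_one (π * ((ℓ : ℝ) + 1) * δ)]
  have hq : 0 ≤ 1 - Real.exp (-(π ^ 2 * ϑ)) := by
    have : Real.exp (-(π ^ 2 * ϑ)) ≤ 1 := by
      rw [Real.exp_le_one_iff]
      have : 0 ≤ π ^ 2 * ϑ := by positivity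
      linarith
    linarith
  have hE : 1 - Real.exp (-(π ^ 2 * ϑ)) ≤ 1 - Real.exp (-(π ^ 2 * ϑ * ((ℓ : ℝ) + 1) ^ 2 * Δ)) := by
    have : π ^ 2 * ϑ ≤ π ^ 2 * ϑ * ((ℓ : ℝ) + 1) ^ 2 * Δ := by
      have h3 : (N : ℝ) ^ 2 * Δ ≤ ((ℓ : ℝ) + 1) ^ 2 * Δ := by gcongr; linarith
      rw [mul_assoc (π ^ 2 * ϑ)]
      exact le_mul_of_one_le_right (by positivity) (by linarith)
    have := Real.exp_le_exp.mpr (neg_le_neg this)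
    linarith
  have hD : π ^ 2 * ϑ * ((ℓ : ℝ) + 1) ^ 2 ≤ 9 * π ^ 2 * ϑ * (N : ℝ) ^ 2 := by
    calc _ ≤ π ^ 2 * ϑ * (3 * (N : ℝ)) ^ 2 := by gcongr
      _ = _ := by ring
  rw [div_mul_eq_mul_div]
  gcongr
  exact mul_nonneg (hq.trans hE) hC0

/-- For every `ϑ > 0` there are constants `c, C > 0` such that for all `δ, Δ ∈ (0,1]`,
`c · min(δ, √Δ) ≤ Φ_ϑ(δ, Δ) ≤ C · min(δ, √Δ)`. -/
theorem Phi_two_sided_bound (ϑ : ℝ) (hϑ : 0 < ϑ) :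
    ∃ c > (0 : ℝ), ∃ C > (0 : ℝ), ∀ δ ∈ Set.Ioc (0 : ℝ) 1, ∀ Δ ∈ Set.Ioc (0 : ℝ) 1,
      c * min δ (Real.sqrt Δ) ≤ Phi ϑ δ Δ ∧ Phi ϑ δ Δ ≤ C * min δ (Real.sqrt Δ) := by
  have hq : 0 < 1 - Real.exp (-(π ^ 2 * ϑ)) := by
    have : Real.exp (-(π ^ 2 * ϑ)) < 1 := by
      rw [Real.exp_lt_one_iff]
      have : 0 < π ^ 2 * ϑ := by positivity
      linarith
    linarith
  refine ⟨(1 - Real.exp (-(π ^ 2 * ϑ))) / (36 * π ^ 2 * ϑ), by positivity,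
    8 * (2 + 1 / ϑ), by positivity, ?_⟩
  rintro δ ⟨hδ0, hδ1⟩ Δ ⟨hΔ0, hΔ1⟩
  have hs0 : 0 < √Δ := Real.sqrt_pos.mpr hΔ0
  have hPhi : Phi ϑ δ Δ = 2 * ∑' ℓ, PhiT ϑ δ Δ ℓ := rfl
  have hnn := PhiT_nonneg ϑ δ Δ hϑ hΔ0
  have hle := PhiT_le ϑ δ Δ hϑ hΔ0
  have hK : 0 ≤ 2 + 1 / ϑ := by positivity
  have b1 := tele_bound δ _ hδ0 hK (PhiT ϑ δ Δ) (fun ℓ => (hle ℓ).2.1) (fun ℓ => (hle ℓ).1)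
  have b2 := tele_bound (√Δ) _ hs0 hK (PhiT ϑ δ Δ) (fun ℓ => (hle ℓ).2.2) (fun ℓ => (hle ℓ).1)
  have hsum : Summable (PhiT ϑ δ Δ) := summable_of_sum_range_le hnn b1
  have t1 := Real.tsum_le_of_sum_range_le hnn b1
  have t2 := Real.tsum_le_of_sum_range_le hnn b2
  rw [hPhi]
  constructor
  · obtain ⟨k, hk1, hk2⟩ := exists_shift δ hδ0 hδ1
    set m := min δ (√Δ) with hm
    have hm0 : 0 < m := lt_min hδ0 hs0
    have hmδ : m ≤ δ := min_le_left _ _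
    have hms : m ≤ √Δ := min_le_right _ _
    set N := ⌈1 / m⌉₊ with hN
    have hN0 : 0 < N := Nat.ceil_pos.mpr (by positivity)
    have hN0' : (0 : ℝ) < N := by exact_mod_cast hN0
    have hN1 : 1 ≤ (N : ℝ) * m := by
      have := Nat.le_ceil (1 / m)
      rwa [div_le_iff₀ hm0] at this
    have hN2 : (N : ℝ) * m ≤ 2 := by
      have := Nat.ceil_lt_add_one (a := 1 / m) (by positivity)
      have h3 : (N : ℝ) * m < (1 / m + 1) * m := by gcongr
      have h4 : (1 / m + 1) * m = 1 + m := by field_simp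
      linarith
    have hkN : k ≤ N := by
      have : (k : ℝ) ≤ N := by
        have h5 : (k : ℝ) * m ≤ N * m := by
          have : (k : ℝ) * m ≤ k * δ := by gcongr
          linarith
        exact le_of_mul_le_mul_right h5 hm0
      exact_mod_cast this
    have hNΔ : 1 ≤ (N : ℝ) ^ 2 * Δ := by
      have h6 : 1 ≤ (N : ℝ) * √Δ := hN1.trans (by gcongr)
      calc (1 : ℝ) ≤ ((N : ℝ) * √Δ) ^ 2 := one_le_pow₀ h6
        _ = _ := by rw [mul_pow, Real.sq_sqrt hΔ0.le]
    have c1 := block_le _ hsum hnn N N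
    have c2 := block_le _ hsum hnn (N + k) N
    set Q := (1 - Real.exp (-(π ^ 2 * ϑ))) / (9 * π ^ 2 * ϑ * (N : ℝ) ^ 2) with hQ
    have hQ0 : 0 < Q := by positivity
    have c3 : ∑ j ∈ Finset.range N, Q * (1 / 2) ≤
        ∑ j ∈ Finset.range N, (PhiT ϑ δ Δ (N + j) + PhiT ϑ δ Δ (N + k + j)) := by
      refine Finset.sum_le_sum fun j hj => ?_
      rw [Finset.mem_range] at hj
      have d1 := PhiT_ge ϑ δ Δ hϑ N (N + j) hN0 (by omega) (by omega) hNΔ hΔ0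
      have d2 := PhiT_ge ϑ δ Δ hϑ N (N + k + j) hN0 (by omega) (by omega) hNΔ hΔ0
      have d3 := cos_pair (π * (((N + j : ℕ) : ℝ) + 1) * δ) (π * (k * δ))
        (by nlinarith [Real.pi_pos]) (by nlinarith [Real.pi_pos])
      have d4 : π * (((N + j : ℕ) : ℝ) + 1) * δ + π * (k * δ)
          = π * (((N + k + j : ℕ) : ℝ) + 1) * δ := by push_cast; ring
      rw [d4] at d3
      have d5 := mul_le_mul_of_nonneg_left d3 hQ0.le
      rw [mul_add] at d5
      linarith
    rw [Finset.sum_add_distrib, Finset.sum_const, Finset.card_range, nsmul_eq_mul] at c3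
    have c4 : (1 - Real.exp (-(π ^ 2 * ϑ))) / (36 * π ^ 2 * ϑ) * m ≤ N * (Q * (1 / 2)) := by
      have e : N * (Q * (1 / 2)) = (1 - Real.exp (-(π ^ 2 * ϑ))) / (36 * π ^ 2 * ϑ) * (2 / N) := by
        rw [hQ]; field_simp; ring
      rw [e]
      gcongr
      rw [le_div_iff₀ hN0']; linarith
    linarith
  · rcases min_choice δ (√Δ) with h | h <;> rw [h] <;> linarith
end
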